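/- A density matrix ρ_ABC on a finite-dimensional Hilbert space H_A ⊗ H_B ⊗ H_C satisfies I(A:C|B)_ρ = 0 if and only if there exist an orthogonal direct sum decomposition H_B = ⊕_{j∈J} H_{b_j^L} ⊗ H_{b_j^R}, density matrices ρ_{A b_j^L} on H_A ⊗ H_{b_j^L} and ρ_{b_j^R C} on H_{b_j^R} ⊗ H_C, and a probability distribution (q_j)_{j∈J}, such that ρ_ABC = ⊕_j q_j ρ_{A b_j^L} ⊗ ρ_{b_j^R C}. -/

import Mathlib

open Matrix Kronecker BigOperators
open scoped ComplexOrder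

/-- A density matrix: a positive semidefinite matrix of trace one. -/
def IsDensityMatrix {n : Type*} [Fintype n] (ρ : Matrix n n ℂ) : Prop :=
  ρ.PosSemidef ∧ ρ.trace = 1

/-- The von Neumann entropy `S(ρ) = -Tr(ρ log ρ)`, computed via the eigenvalues of a
Hermitian matrix (with the convention `0 log 0 = 0`). -/
noncomputable def vNEntropy {n : Type*} [Fintype n] [DecidableEq n]
    (ρ : Matrix n n ℂ) : ℝ :=
  if h : ρ.IsHermitian then -∑ i, h.eigenvalues i * Real.log (h.eigenvalues i) else 0

/-- Reduced density matrix on `A × B` (partial trace over `C`). -/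
noncomputable def margAB {A B C : Type*} [Fintype C]
    (ρ : Matrix (A × B × C) (A × B × C) ℂ) : Matrix (A × B) (A × B) ℂ :=
  Matrix.of fun p q => ∑ c : C, ρ (p.1, p.2, c) (q.1, q.2, c)

/-- Reduced density matrix on `B × C` (partial trace over `A`). -/
noncomputable def margBC {A B C : Type*} [Fintype A]
    (ρ : Matrix (A × B × C) (A × B × C) ℂ) : Matrix (B × C) (B × C) ℂ :=
  Matrix.of fun p q => ∑ a : A, ρ (a, p) (a, q)

/-- Reduced density matrix on `B` (partial trace over `A` and `C`). -/
noncomputable def margB {A B C : Type*} [Fintype A] [Fintype C]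
    (ρ : Matrix (A × B × C) (A × B × C) ℂ) : Matrix B B ℂ :=
  Matrix.of fun b b' => ∑ a : A, ∑ c : C, ρ (a, b, c) (a, b', c)

/-- Conditional mutual information `I(A:C|B) = S(AB) + S(BC) - S(B) - S(ABC)`. -/
noncomputable def CMI {A B C : Type*} [Fintype A] [DecidableEq A]
    [Fintype B] [DecidableEq B] [Fintype C] [DecidableEq C]
    (ρ : Matrix (A × B × C) (A × B × C) ℂ) : ℝ :=
  vNEntropy (margAB ρ) + vNEntropy (margBC ρ) - vNEntropy (margB ρ) - vNEntropy ρ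

/-- Reassociation of indices `Σ j, (A × bLⱼ) × (bRⱼ × C) ≃ A × (Σ j, bLⱼ × bRⱼ) × C`. -/
def assocEquiv (A C : Type*) {J : Type*} (bL bR : J → Type*) :
    (Σ j, (A × bL j) × (bR j × C)) ≃ A × (Σ j, bL j × bR j) × C where
  toFun x := (x.2.1.1, ⟨x.1, (x.2.1.2, x.2.2.1)⟩, x.2.2.2)
  invFun y := ⟨y.2.1.1, ((y.1, y.2.1.2.1), (y.2.1.2.2, y.2.2))⟩
  left_inv _ := rfl
  right_inv _ := rfl

/-- The block-diagonal density matrix `⊕ⱼ qⱼ · ρ_{A bLⱼ} ⊗ ρ_{bRⱼ C}` on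
`H_A ⊗ (⊕ⱼ H_{bLⱼ} ⊗ H_{bRⱼ}) ⊗ H_C`. -/
noncomputable def blockState {A C : Type*} {J : Type*} [DecidableEq J]
    (bL bR : J → Type*)
    (q : J → ℝ)
    (ρL : ∀ j, Matrix (A × bL j) (A × bL j) ℂ)
    (ρR : ∀ j, Matrix (bR j × C) (bR j × C) ℂ) :
    Matrix (A × (Σ j, bL j × bR j) × C) (A × (Σ j, bL j × bR j) × C) ℂ :=
  Matrix.reindex (assocEquiv A C bL bR) (assocEquiv A C bL bR)
    (Matrix.blockDiagonal' fun j => (q j : ℂ) • (ρL j ⊗ₖ ρR j))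

open Filter Topology in
/-- A signed logarithmic sum whose interpolating derivative is nonnegative vanishes exactly when
that derivative vanishes identically. -/
theorem sum_log_sub_log_eq_zero_iff {s : Type*} [Fintype s] (c d e : s → ℝ)
    (hc : ∑ i, c i = 0) (hd : ∀ i, c i ≠ 0 → 0 < d i) (he : ∀ i, c i ≠ 0 → 0 < e i)
    (hF : ∀ t > 0, 0 ≤ ∑ i, c i * e i / (d i + t * e i)) :
    ∑ i, c i * (Real.log (e i) - Real.log (d i)) = 0 ↔
      ∀ t > 0, ∑ i, c i * e i / (d i + t * e i) = 0 := by
  set h : ℝ → ℝ := fun t => ∑ i, c i * Real.log (d i + t * e i) with hh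
  have hder : ∀ t, 0 ≤ t → HasDerivAt h (∑ i, c i * e i / (d i + t * e i)) t := by
    intro t ht
    apply HasDerivAt.fun_sum
    intro i _
    by_cases hi : c i = 0
    · simpa [hi] using hasDerivAt_const t (0 : ℝ)
    · have hp : 0 < d i + t * e i := by
        have := hd i hi; have := he i hi; positivity
      have h1 : HasDerivAt (fun t => d i + t * e i) (e i) t := by
        simpa using ((hasDerivAt_id t).mul_const (e i)).const_add (d i)
      have := (h1.log hp.ne').const_mul (c i)
      rwa [← mul_div_assoc] at this
  have hlim : Tendsto h atTop (𝓝 (∑ i, c i * Real.log (e i))) := by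
    have h2 : Tendsto (fun t : ℝ => ∑ i, c i * Real.log (d i / t + e i)) atTop
        (𝓝 (∑ i, c i * Real.log (e i))) := by
      apply tendsto_finsetSum
      intro i _
      by_cases hi : c i = 0
      · simp [hi]
      · have h3 : Tendsto (fun t : ℝ => d i / t + e i) atTop (𝓝 (e i)) := by
          simpa using (tendsto_const_nhds (x := d i)).div_atTop tendsto_id |>.add_const (e i)
        exact (((Real.continuousAt_log (he i hi).ne').tendsto.comp h3)).const_mul _
    refine h2.congr' ?_
    filter_upwards [eventually_gt_atTop 0] with t ht
    have h4 : ∀ i, c i * Real.log (d i / t + e i) =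
        c i * Real.log (d i + t * e i) - c i * Real.log t := by
      intro i
      by_cases hi : c i = 0
      · simp [hi]
      · have := hd i hi
        have := he i hi
        rw [show d i / t + e i = (d i + t * e i) / t by field_simp,
          Real.log_div (by positivity) ht.ne']
        ring
    rw [Finset.sum_congr rfl fun i _ => h4 i, Finset.sum_sub_distrib, ← Finset.sum_mul, hc]
    simp [hh]
  have h0 : h 0 = ∑ i, c i * Real.log (d i) := by simp [hh]
  have key : ∑ i, c i * (Real.log (e i) - Real.log (d i)) =
      ∑ i, c i * Real.log (e i) - h 0 := by
    rw [h0, ← Finset.sum_sub_distrib]; simp [mul_sub]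
  have hcont : ContinuousOn h (Set.Ici 0) := fun t ht =>
    (hder t ht).continuousAt.continuousWithinAt
  have hmono : MonotoneOn h (Set.Ici 0) := by
    apply monotoneOn_of_deriv_nonneg (convex_Ici 0) hcont
    · intro t ht
      rw [interior_Ici] at ht
      exact (hder t (le_of_lt ht)).differentiableAt.differentiableWithinAt
    · intro t ht
      rw [interior_Ici] at ht
      rw [(hder t (le_of_lt ht)).deriv]
      exact hF t ht
  rw [key]
  constructor
  · intro hz
    have hconst : ∀ t, 0 ≤ t → h t = h 0 := by
      intro t ht
      apply le_antisymm
      · have : h t ≤ ∑ i, c i * Real.log (e i) := by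
          apply ge_of_tendsto hlim
          filter_upwards [eventually_ge_atTop t] with u hu
          exact hmono ht (ht.trans hu) hu
        linarith
      · exact hmono Set.self_mem_Ici ht ht
    intro t ht
    have h5 : HasDerivAt h 0 t := by
      apply (hasDerivAt_const t (h 0)).congr_of_eventuallyEq
      filter_upwards [eventually_gt_nhds ht] with u hu
      exact hconst u hu.le
    exact (hder t ht.le).unique h5
  · intro hz
    have hconst : ∀ t, 0 ≤ t → h t = h 0 := by
      intro t ht
      apply le_antisymm _ (hmono Set.self_mem_Ici ht ht)
      have hanti : AntitoneOn h (Set.Ici 0) := by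
        apply antitoneOn_of_deriv_nonpos (convex_Ici 0) hcont
        · intro t ht
          rw [interior_Ici] at ht
          exact (hder t (le_of_lt ht)).differentiableAt.differentiableWithinAt
        · intro t ht
          rw [interior_Ici] at ht
          rw [(hder t (le_of_lt ht)).deriv, hz t ht]
      exact hanti Set.self_mem_Ici ht ht
    have : Tendsto h atTop (𝓝 (h 0)) := by
      apply tendsto_const_nhds.congr'
      filter_upwards [eventually_ge_atTop 0] with u hu
      exact (hconst u hu).symm
    rw [tendsto_nhds_unique hlim this, sub_self]

/-- `A` is diagonalized by the unitary `U` with real diagonal `d`. -/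
structure IsDiagonalization {n : Type*} [Fintype n] [DecidableEq n]
    (A U : Matrix n n ℂ) (d : n → ℝ) : Prop where
  left : Uᴴ * U = 1
  right : U * Uᴴ = 1
  eq : A = U * diagonal (fun i => (d i : ℂ)) * Uᴴ

theorem Matrix.IsHermitian.isDiagonalization {n : Type*} [Fintype n] [DecidableEq n]
    {A : Matrix n n ℂ} (hA : A.IsHermitian) :
    IsDiagonalization A hA.eigenvectorUnitary hA.eigenvalues where
  left := Unitary.coe_star_mul_self _
  right := Unitary.coe_mul_star_self _
  eq := hA.spectral_theorem

theorem IsDiagonalization.conj_eq {n : Type*} [Fintype n] [DecidableEq n]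
    {A U : Matrix n n ℂ} {d : n → ℝ} (h : IsDiagonalization A U d) :
    Uᴴ * A * U = diagonal (fun i => (d i : ℂ)) := by
  rw [h.eq]
  calc _ = (Uᴴ * U) * diagonal (fun i => (d i : ℂ)) * (Uᴴ * U) := by simp only [Matrix.mul_assoc]
    _ = _ := by simp [h.left]

theorem IsDiagonalization.trace_eq {n : Type*} [Fintype n] [DecidableEq n]
    {A U : Matrix n n ℂ} {d : n → ℝ} (h : IsDiagonalization A U d) :
    A.trace = ((∑ i, d i : ℝ) : ℂ) := by
  rw [h.eq, Matrix.trace_mul_comm, ← Matrix.mul_assoc, h.left, Matrix.one_mul, Matrix.trace_diagonal]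
  simp

theorem Matrix.PosSemidef.mul_eq_zero_of_conj {n m : Type*} [Fintype n] [Fintype m]
    {σ : Matrix n n ℂ} (hσ : σ.PosSemidef) {Z : Matrix n m ℂ} (h : Zᴴ * σ * Z = 0) :
    σ * Z = 0 := by
  ext i j
  have h1 : star (Z.col j) ⬝ᵥ (σ *ᵥ Z.col j) = 0 := by
    rw [← Matrix.zero_apply j j, ← h, Matrix.mul_assoc]
    rfl
  exact congrFun ((hσ.dotProduct_mulVec_zero_iff _).1 h1) i

section Overlap

variable {n : Type*} [Fintype n]

/-- Squared overlaps of the columns of two matrices. -/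
noncomputable def overlap (U V : Matrix n n ℂ) (i j : n) : ℝ := Complex.normSq ((Uᴴ * V) i j)

theorem overlap_nonneg (U V : Matrix n n ℂ) (i j : n) : 0 ≤ overlap U V i j :=
  Complex.normSq_nonneg _

variable [DecidableEq n]

theorem sum_overlap {U V : Matrix n n ℂ} (hU : U * Uᴴ = 1) (hV : Vᴴ * V = 1) (j : n) :
    ∑ i, overlap U V i j = 1 := by
  have h : (Uᴴ * V)ᴴ * (Uᴴ * V) = 1 := by
    rw [Matrix.conjTranspose_mul, Matrix.conjTranspose_conjTranspose, Matrix.mul_assoc,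
      ← Matrix.mul_assoc U, hU, Matrix.one_mul, hV]
  have h2 := congrFun (congrFun h j) j
  rw [Matrix.mul_apply, Matrix.one_apply_eq] at h2
  have h3 : ((∑ i, overlap U V i j : ℝ) : ℂ) = 1 := by
    rw [← h2, Complex.ofReal_sum]
    refine Finset.sum_congr rfl fun i _ => ?_
    rw [Matrix.conjTranspose_apply, overlap, Complex.normSq_eq_conj_mul_self]
    rfl
  exact_mod_cast h3

theorem IsDiagonalization.sum_overlap_mul {ρ V : Matrix n n ℂ} {e : n → ℝ}
    (hρ : IsDiagonalization ρ V e) (U : Matrix n n ℂ) (i : n) :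
    ∑ j, overlap U V i j * e j = ((Uᴴ * ρ * U) i i).re := by
  have h : Uᴴ * ρ * U = (Uᴴ * V) * diagonal (fun i => (e i : ℂ)) * (Uᴴ * V)ᴴ := by
    rw [hρ.eq, Matrix.conjTranspose_mul, Matrix.conjTranspose_conjTranspose]
    simp only [Matrix.mul_assoc]
  have h2 : (Uᴴ * ρ * U) i i = ((∑ j, overlap U V i j * e j : ℝ) : ℂ) := by
    rw [h, Matrix.mul_apply, Complex.ofReal_sum]
    refine Finset.sum_congr rfl fun j _ => ?_
    rw [Matrix.mul_diagonal, Matrix.conjTranspose_apply, overlap, Complex.ofReal_mul,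
      Complex.normSq_eq_conj_mul_self]
    simp only [RCLike.star_def]
    ring
  rw [h2, Complex.ofReal_re]

/-- The Sylvester equation `σ X + t X ρ = ρ` is solvable for positive semidefinite data. -/
theorem exists_sylvester {σ ρ U V : Matrix n n ℂ} {d e : n → ℝ}
    (hσ : IsDiagonalization σ U d) (hρ : IsDiagonalization ρ V e)
    (hd : ∀ i, 0 ≤ d i) (he : ∀ i, 0 ≤ e i) {t : ℝ} (ht : 0 < t) :
    ∃ X : Matrix n n ℂ, σ * X + (t : ℂ) • (X * ρ) = ρ ∧
      (ρ * X).trace = ((∑ i, ∑ j, overlap U V i j * e j * e j / (d i + t * e j) : ℝ) : ℂ) := by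
  set M := Uᴴ * V with hM
  set Y : Matrix n n ℂ := Matrix.of fun i j => M i j * ((e j / (d i + t * e j) : ℝ) : ℂ) with hY
  have hUM : U * M = V := by rw [hM, ← Matrix.mul_assoc, hσ.right, Matrix.one_mul]
  have hYeq : diagonal (fun i => (d i : ℂ)) * Y + (t : ℂ) • (Y * diagonal (fun i => (e i : ℂ))) =
      M * diagonal (fun i => (e i : ℂ)) := by
    ext i j
    simp only [Matrix.add_apply, Matrix.smul_apply, Matrix.diagonal_mul, Matrix.mul_diagonal, hY,
      Matrix.of_apply, smul_eq_mul]
    have key : (d i + t * e j) * (e j / (d i + t * e j)) = e j := by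
      by_cases h0 : d i + t * e j = 0
      · have : e j = 0 := by
          have h1 := hd i
          have h2 := he j
          have h3 : 0 ≤ t * e j := by positivity
          have h4 : t * e j = 0 := by linarith
          simpa [ht.ne'] using h4
        simp [this]
      · field_simp
    have key2 : ((d i : ℂ) + t * e j) * ((e j / (d i + t * e j) : ℝ) : ℂ) = e j := by
      exact_mod_cast congrArg (fun x : ℝ => (x : ℂ)) key
    linear_combination M i j * key2
  refine ⟨U * Y * Vᴴ, ?_, ?_⟩
  · have h1 : σ * (U * Y * Vᴴ) = U * (diagonal (fun i => (d i : ℂ)) * Y) * Vᴴ := by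
      rw [hσ.eq]
      calc _ = U * diagonal (fun i => (d i : ℂ)) * (Uᴴ * U) * Y * Vᴴ := by
            simp only [Matrix.mul_assoc]
        _ = _ := by simp only [hσ.left, Matrix.mul_one, Matrix.mul_assoc]
    have h2 : (U * Y * Vᴴ) * ρ = U * (Y * diagonal (fun i => (e i : ℂ))) * Vᴴ := by
      rw [hρ.eq]
      calc _ = U * Y * (Vᴴ * V) * diagonal (fun i => (e i : ℂ)) * Vᴴ := by
            simp only [Matrix.mul_assoc]
        _ = _ := by simp only [hρ.left, Matrix.mul_one, Matrix.mul_assoc]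
    rw [h1, h2, ← Matrix.smul_mul, ← Matrix.mul_smul, ← Matrix.add_mul, ← Matrix.mul_add, hYeq,
      ← Matrix.mul_assoc, hUM, hρ.eq]
  · have h1 : (ρ * (U * Y * Vᴴ)).trace = (diagonal (fun i => (e i : ℂ)) * (Mᴴ * Y)).trace := by
      have : ρ * (U * Y * Vᴴ) = V * (diagonal (fun i => (e i : ℂ)) * (Mᴴ * Y)) * Vᴴ := by
        rw [hρ.eq, hM, Matrix.conjTranspose_mul, Matrix.conjTranspose_conjTranspose]
        simp only [Matrix.mul_assoc]
      rw [this, Matrix.trace_mul_comm, ← Matrix.mul_assoc, hρ.left, Matrix.one_mul]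
    rw [h1, Matrix.trace, Finset.sum_comm, Complex.ofReal_sum]
    refine Finset.sum_congr rfl fun j _ => ?_
    rw [Matrix.diag_apply, Matrix.diagonal_mul, Matrix.mul_apply, Finset.mul_sum,
      Complex.ofReal_sum]
    refine Finset.sum_congr rfl fun i _ => ?_
    rw [Matrix.conjTranspose_apply, hY, Matrix.of_apply]
    have h2 : ((overlap U V i j : ℝ) : ℂ) = star (M i j) * M i j := by
      rw [overlap, Complex.normSq_eq_conj_mul_self]; rfl
    rw [mul_assoc (overlap U V i j), mul_div_assoc, mul_div_assoc, Complex.ofReal_mul, h2]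
    push_cast
    ring

end Overlap

theorem trace_sylvester_symm {n : Type*} [Fintype n] {σ ρ X X' : Matrix n n ℂ}
    (hσ : σ.IsHermitian) (hρ : ρ.IsHermitian) {t : ℝ}
    (hX : σ * X + (t : ℂ) • (X * ρ) = ρ) (hX' : σ * X' + (t : ℂ) • (X' * ρ) = ρ) :
    (Xᴴ * ρ).trace = (ρ * X').trace := by
  have h1 : Xᴴ * σ + (t : ℂ) • (ρ * Xᴴ) = ρ := by
    have := congrArg Matrix.conjTranspose hX
    simpa [Matrix.conjTranspose_add, Matrix.conjTranspose_smul, Matrix.conjTranspose_mul,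
      hσ.eq, hρ.eq] using this
  calc (Xᴴ * ρ).trace = (Xᴴ * (σ * X' + (t : ℂ) • (X' * ρ))).trace := by rw [hX']
    _ = ((Xᴴ * σ + (t : ℂ) • (ρ * Xᴴ)) * X').trace := by
        rw [Matrix.mul_add, Matrix.add_mul, Matrix.trace_add, Matrix.trace_add,
          Matrix.mul_smul, Matrix.smul_mul, Matrix.trace_smul, Matrix.trace_smul,
          ← Matrix.mul_assoc Xᴴ X', Matrix.trace_mul_comm (Xᴴ * X'), Matrix.mul_assoc,
          Matrix.mul_assoc]
    _ = _ := by rw [h1]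

theorem IsDiagonalization.posSemidef {n : Type*} [Fintype n] [DecidableEq n]
    {A U : Matrix n n ℂ} {d : n → ℝ} (h : IsDiagonalization A U d) (hd : ∀ i, 0 ≤ d i) :
    A.PosSemidef := by
  rw [h.eq]
  exact (Matrix.PosSemidef.diagonal fun i => by simpa using hd i).mul_mul_conjTranspose_same U

section RelativeEntropy

namespace IsDiagonalization

variable {n : Type*} [Fintype n] [DecidableEq n] {ρ U V : Matrix n n ℂ} {d e : n → ℝ}

theorem sum_sum_overlap_mul (h : IsDiagonalization ρ V e) (hU : U * Uᴴ = 1) :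
    ∑ p : n × n, overlap U V p.1 p.2 * e p.2 = ∑ i, e i := by
  rw [Fintype.sum_prod_type, Finset.sum_comm]
  exact Finset.sum_congr rfl fun j _ => by
    simp only [← Finset.sum_mul, sum_overlap hU h.left, one_mul]

theorem pos_of_overlap_mul_ne_zero (h : IsDiagonalization ρ V e) (he : ∀ i, 0 ≤ e i)
    (hd : ∀ i, 0 ≤ d i) (hs : ∀ i, d i = 0 → ((Uᴴ * ρ * U) i i).re = 0) {i j : n}
    (hij : overlap U V i j * e j ≠ 0) : 0 < d i ∧ 0 < e j := by
  refine ⟨(hd i).lt_of_ne' fun h0 => hij ?_, (he j).lt_of_ne' fun h0 => hij (by simp [h0])⟩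
  have h1 := hs i h0
  rw [← h.sum_overlap_mul U i] at h1
  exact (Finset.sum_eq_zero_iff_of_nonneg fun j _ =>
    mul_nonneg (overlap_nonneg U V i j) (he j)).1 h1 j (Finset.mem_univ j)

theorem sum_overlap_mul_log (h : IsDiagonalization ρ V e) (hU : U * Uᴴ = 1) :
    ∑ p : n × n, overlap U V p.1 p.2 * e p.2 * (Real.log (e p.2) - Real.log (d p.1)) =
      ∑ i, e i * Real.log (e i) - ∑ i, ((Uᴴ * ρ * U) i i).re * Real.log (d i) := by
  simp only [mul_sub, Finset.sum_sub_distrib]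
  rw [Fintype.sum_prod_type, Fintype.sum_prod_type, Finset.sum_comm]
  congr 1
  · exact Finset.sum_congr rfl fun j _ => by
      simp only [← Finset.sum_mul, sum_overlap hU h.left, one_mul]
  · exact Finset.sum_congr rfl fun i _ => by
      simp only [← Finset.sum_mul, h.sum_overlap_mul]

end IsDiagonalization

variable {k n : Type*} [Fintype k] [DecidableEq k] [Fintype n] [DecidableEq n]

theorem trace_sylvester_sub {ι : Matrix k k ℂ →⋆ₐ[ℂ] Matrix n n ℂ}
    {E : Matrix n n ℂ → Matrix k k ℂ}
    (hadj : ∀ X Y, (ι X * Y).trace = (X * E Y).trace)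
    {σ ρ : Matrix n n ℂ} (hσ : σ.IsHermitian) (hρ : ρ.IsHermitian)
    {t : ℝ} {X : Matrix n n ℂ} {X₀ : Matrix k k ℂ}
    (hX : σ * X + (t : ℂ) • (X * ρ) = ρ)
    (hX₀ : E σ * X₀ + (t : ℂ) • (X₀ * E ρ) = E ρ) :
    ((X - ι X₀)ᴴ * σ * (X - ι X₀)).trace + t * ((X - ι X₀) * ρ * (X - ι X₀)ᴴ).trace =
      (ρ * X).trace - (E ρ * X₀).trace := by
  have h1 : Xᴴ * σ + (t : ℂ) • (ρ * Xᴴ) = ρ := by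
    have := congrArg Matrix.conjTranspose hX
    simpa [Matrix.conjTranspose_add, Matrix.conjTranspose_smul, Matrix.conjTranspose_mul,
      hσ.eq, hρ.eq] using this
  have hs : ∀ M : Matrix k k ℂ, (ι M)ᴴ = ι Mᴴ := fun M => (map_star ι M).symm
  have e1 : (Xᴴ * σ * X).trace + t * (ρ * Xᴴ * X).trace = (ρ * X).trace := by
    have := congrArg (fun M => (M * X).trace) h1
    simpa [Matrix.add_mul] using this
  have e2 : (Xᴴ * σ * ι X₀).trace + t * (ρ * Xᴴ * ι X₀).trace = (E ρ * X₀).trace := by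
    have := congrArg (fun M => (M * ι X₀).trace) h1
    simp only [Matrix.add_mul, Matrix.trace_add, Matrix.smul_mul, Matrix.trace_smul,
      smul_eq_mul] at this
    rw [this, Matrix.trace_mul_comm, hadj, Matrix.trace_mul_comm]
  have e3 : (ι X₀ᴴ * σ * X).trace + t * (ι X₀ᴴ * X * ρ).trace = (X₀ᴴ * E ρ).trace := by
    have := congrArg (fun M => (ι X₀ᴴ * M).trace) hX
    simp only [Matrix.mul_add, Matrix.trace_add, Matrix.mul_smul, Matrix.trace_smul,
      smul_eq_mul, ← Matrix.mul_assoc] at this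
    rw [this, hadj]
  have e4 : (ι X₀ᴴ * σ * ι X₀).trace + t * (ι X₀ᴴ * ι X₀ * ρ).trace = (X₀ᴴ * E ρ).trace := by
    have := congrArg (fun M => (X₀ᴴ * M).trace) hX₀
    simp only [Matrix.mul_add, Matrix.trace_add, Matrix.mul_smul, Matrix.trace_smul,
      smul_eq_mul, ← Matrix.mul_assoc] at this
    rw [← this, Matrix.trace_mul_comm, ← Matrix.mul_assoc, ← map_mul, hadj, ← map_mul, hadj,
      Matrix.mul_assoc X₀, Matrix.trace_mul_comm X₀]
  have r1 : (X * ρ * Xᴴ).trace = (ρ * Xᴴ * X).trace := by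
    rw [Matrix.mul_assoc, Matrix.trace_mul_comm]
  have r2 : (ι X₀ * ρ * Xᴴ).trace = (ρ * Xᴴ * ι X₀).trace := by
    rw [Matrix.mul_assoc, Matrix.trace_mul_comm]
  have r3 : (X * ρ * ι X₀ᴴ).trace = (ι X₀ᴴ * X * ρ).trace := by
    rw [Matrix.trace_mul_comm, Matrix.mul_assoc]
  have r4 : (ι X₀ * ρ * ι X₀ᴴ).trace = (ι X₀ᴴ * ι X₀ * ρ).trace := by
    rw [Matrix.trace_mul_comm, Matrix.mul_assoc]
  simp only [Matrix.conjTranspose_sub, hs, Matrix.sub_mul, Matrix.mul_sub, Matrix.trace_sub,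
    r1, r2, r3, r4]
  linear_combination e1 - e2 - e3 + e4

/-- Equality in the monotonicity of relative entropy under a conditional expectation, in terms of
the Sylvester equations of the two states. -/
theorem relEntropy_eq_iff_sylvester {ι : Matrix k k ℂ →⋆ₐ[ℂ] Matrix n n ℂ}
    {E : Matrix n n ℂ → Matrix k k ℂ}
    (hadj : ∀ X Y, (ι X * Y).trace = (X * E Y).trace)
    {σ ρ U V : Matrix n n ℂ} {d e : n → ℝ} {U₀ V₀ : Matrix k k ℂ} {d₀ e₀ : k → ℝ}
    (hσ : IsDiagonalization σ U d) (hρ : IsDiagonalization ρ V e)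
    (hσ₀ : IsDiagonalization (E σ) U₀ d₀) (hρ₀ : IsDiagonalization (E ρ) V₀ e₀)
    (hd : ∀ i, 0 ≤ d i) (he : ∀ i, 0 ≤ e i) (hd₀ : ∀ i, 0 ≤ d₀ i) (he₀ : ∀ i, 0 ≤ e₀ i)
    (hsupp : ∀ i, d i = 0 → ((Uᴴ * ρ * U) i i).re = 0)
    (hsupp₀ : ∀ i, d₀ i = 0 → ((U₀ᴴ * E ρ * U₀) i i).re = 0) :
    (∑ i, e i * Real.log (e i) - ∑ i, ((Uᴴ * ρ * U) i i).re * Real.log (d i) =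
      ∑ i, e₀ i * Real.log (e₀ i) - ∑ i, ((U₀ᴴ * E ρ * U₀) i i).re * Real.log (d₀ i)) ↔
      ∀ t : ℝ, 0 < t → ∃ X : Matrix k k ℂ, σ * ι X + (t : ℂ) • (ι X * ρ) = ρ := by
  have pσ := hσ.posSemidef hd
  have pρ := hρ.posSemidef he
  set c : (n × n) ⊕ (k × k) → ℝ := Sum.elim (fun p => overlap U V p.1 p.2 * e p.2)
    (fun p => -(overlap U₀ V₀ p.1 p.2 * e₀ p.2)) with hc
  set D : (n × n) ⊕ (k × k) → ℝ := Sum.elim (fun p => d p.1) (fun p => d₀ p.1) with hD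
  set G : (n × n) ⊕ (k × k) → ℝ := Sum.elim (fun p => e p.2) (fun p => e₀ p.2) with hG
  have hFfull : ∀ t, (∑ p : n × n, overlap U V p.1 p.2 * e p.2 * e p.2 / (d p.1 + t * e p.2)) =
      ∑ i, ∑ j, overlap U V i j * e j * e j / (d i + t * e j) := fun t =>
    Fintype.sum_prod_type _
  have hFred : ∀ t, (∑ p : k × k, -(overlap U₀ V₀ p.1 p.2 * e₀ p.2) * e₀ p.2 /
      (d₀ p.1 + t * e₀ p.2)) =
      -∑ i, ∑ j, overlap U₀ V₀ i j * e₀ j * e₀ j / (d₀ i + t * e₀ j) := fun t => by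
    rw [Fintype.sum_prod_type]
    simp only [neg_mul, neg_div, Finset.sum_neg_distrib]
  have hgap : ∀ t : ℝ, 0 < t → ∃ X X₀, σ * X + (t : ℂ) • (X * ρ) = ρ ∧
      E σ * X₀ + (t : ℂ) • (X₀ * E ρ) = E ρ ∧
      ((∑ s, c s * G s / (D s + t * G s) : ℝ) : ℂ) = (ρ * X).trace - (E ρ * X₀).trace := by
    intro t ht
    obtain ⟨X, hX, hXt⟩ := exists_sylvester hσ hρ hd he ht
    obtain ⟨X₀, hX₀, hX₀t⟩ := exists_sylvester hσ₀ hρ₀ hd₀ he₀ ht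
    refine ⟨X, X₀, hX, hX₀, ?_⟩
    rw [hXt, hX₀t, Fintype.sum_sum_type]
    simp only [hc, hD, hG, Sum.elim_inl, Sum.elim_inr, hFfull, hFred]
    push_cast
    ring
  have hpos : ∀ (t : ℝ) (Z : Matrix n n ℂ), 0 < t →
      0 ≤ (Zᴴ * σ * Z).trace ∧ 0 ≤ (t : ℂ) * (Z * ρ * Zᴴ).trace := fun t Z ht =>
    ⟨(pσ.conjTranspose_mul_mul_same Z).trace_nonneg,
      mul_nonneg (by exact_mod_cast ht.le) (pρ.mul_mul_conjTranspose_same Z).trace_nonneg⟩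
  have htr : ∑ i, e i = ∑ i, e₀ i := by
    have h := hadj 1 ρ
    rw [map_one, Matrix.one_mul, Matrix.one_mul, hρ.trace_eq, hρ₀.trace_eq] at h
    exact_mod_cast h
  have key := sum_log_sub_log_eq_zero_iff c D G
    (by
      rw [Fintype.sum_sum_type]
      simp only [hc, Sum.elim_inl, Sum.elim_inr, Finset.sum_neg_distrib]
      rw [hρ.sum_sum_overlap_mul hσ.right, hρ₀.sum_sum_overlap_mul hσ₀.right, htr, add_neg_cancel])
    (by
      rintro (⟨i, j⟩ | ⟨i, j⟩) h
      · exact (hρ.pos_of_overlap_mul_ne_zero he hd hsupp h).1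
      · exact (hρ₀.pos_of_overlap_mul_ne_zero he₀ hd₀ hsupp₀ (neg_ne_zero.1 h)).1)
    (by
      rintro (⟨i, j⟩ | ⟨i, j⟩) h
      · exact (hρ.pos_of_overlap_mul_ne_zero he hd hsupp h).2
      · exact (hρ₀.pos_of_overlap_mul_ne_zero he₀ hd₀ hsupp₀ (neg_ne_zero.1 h)).2)
    (by
      intro t ht
      obtain ⟨X, X₀, hX, hX₀, h⟩ := hgap t ht
      rw [← trace_sylvester_sub hadj pσ.1 pρ.1 hX hX₀] at h
      have := hpos t (X - ι X₀) ht
      have h2 := add_nonneg this.1 this.2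
      rw [← h] at h2
      exact_mod_cast h2)
  have hlog : ∑ s, c s * (Real.log (G s) - Real.log (D s)) =
      (∑ i, e i * Real.log (e i) - ∑ i, ((Uᴴ * ρ * U) i i).re * Real.log (d i)) -
      (∑ i, e₀ i * Real.log (e₀ i) - ∑ i, ((U₀ᴴ * E ρ * U₀) i i).re * Real.log (d₀ i)) := by
    rw [Fintype.sum_sum_type]
    simp only [hc, hD, hG, Sum.elim_inl, Sum.elim_inr, neg_mul, Finset.sum_neg_distrib]
    rw [hρ.sum_overlap_mul_log hσ.right, hρ₀.sum_overlap_mul_log hσ₀.right, ← sub_eq_add_neg]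
  rw [← sub_eq_zero, ← hlog, key]
  refine forall₂_congr fun t ht => ?_
  obtain ⟨X, X₀, hX, hX₀, h⟩ := hgap t ht
  constructor
  · intro h0
    refine ⟨X₀, ?_⟩
    rw [h0, ← trace_sylvester_sub hadj pσ.1 pρ.1 hX hX₀, Complex.ofReal_zero] at h
    obtain ⟨p1, p2⟩ := hpos t (X - ι X₀) ht
    obtain ⟨z1, z2⟩ := (add_eq_zero_iff_of_nonneg p1 p2).1 h.symm
    have y1 := pσ.mul_eq_zero_of_conj
      ((pσ.conjTranspose_mul_mul_same (X - ι X₀)).trace_eq_zero_iff.1 z1)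
    have y2 : ρ * (X - ι X₀)ᴴ = 0 := by
      apply pρ.mul_eq_zero_of_conj
      rw [Matrix.conjTranspose_conjTranspose]
      exact (pρ.mul_mul_conjTranspose_same (X - ι X₀)).trace_eq_zero_iff.1
        ((mul_eq_zero.1 z2).resolve_left (by exact_mod_cast ht.ne'))
    have y3 : (X - ι X₀) * ρ = 0 := by
      have := congrArg Matrix.conjTranspose y2
      simpa only [Matrix.conjTranspose_mul, Matrix.conjTranspose_conjTranspose, pρ.1.eq,
        Matrix.conjTranspose_zero] using this
    rw [Matrix.mul_sub, sub_eq_zero] at y1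
    rw [Matrix.sub_mul, sub_eq_zero] at y3
    rw [← y1, ← y3, hX]
  · rintro ⟨X₁, hX₁⟩
    have hX₁' : E σ * X₁ + (t : ℂ) • (X₁ * E ρ) = E ρ := by
      refine Matrix.ext_iff_trace_mul_left.2 fun M => ?_
      have := congrArg (fun Q => (ι M * Q).trace) hX₁
      simp only [Matrix.mul_add, Matrix.mul_smul, Matrix.trace_add, Matrix.trace_smul] at this ⊢
      have h1 : (ι M * (σ * ι X₁)).trace = (M * (E σ * X₁)).trace := by
        rw [← Matrix.mul_assoc, Matrix.trace_mul_comm, ← Matrix.mul_assoc, ← map_mul, hadj,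
          Matrix.mul_assoc, Matrix.trace_mul_comm X₁, Matrix.mul_assoc]
      have h2 : (ι M * (ι X₁ * ρ)).trace = (M * (X₁ * E ρ)).trace := by
        rw [← Matrix.mul_assoc, ← map_mul, hadj, Matrix.mul_assoc]
      rw [← hadj M ρ, ← this, h1, h2]
    have s1 := trace_sylvester_symm pσ.1 pρ.1 hX hX
    have s2 := trace_sylvester_symm pσ.1 pρ.1 hX hX₁
    have s3 := trace_sylvester_symm (hσ₀.posSemidef hd₀).1 (hρ₀.posSemidef he₀).1 hX₀ hX₀
    have s4 := trace_sylvester_symm (hσ₀.posSemidef hd₀).1 (hρ₀.posSemidef he₀).1 hX₀ hX₁'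
    have s5 : (ρ * ι X₁).trace = (E ρ * X₁).trace := by
      rw [Matrix.trace_mul_comm, hadj, Matrix.trace_mul_comm]
    rw [← s1, s2, s5, ← s4, s3, sub_self] at h
    exact_mod_cast h

end RelativeEntropy

section Amplification

variable {l n r : Type*} [Fintype r]

/-- The partial trace over the factor `r`, along `f : l ≃ n × r`. -/
def ptr (f : l ≃ n × r) (W : Matrix l l ℂ) : Matrix n n ℂ :=
  Matrix.of fun i j => ∑ c, W (f.symm (i, c)) (f.symm (j, c))

theorem ptr_add (f : l ≃ n × r) (V W : Matrix l l ℂ) : ptr f (V + W) = ptr f V + ptr f W := by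
  ext i j
  simp [ptr, Finset.sum_add_distrib]

theorem ptr_smul (f : l ≃ n × r) (z : ℂ) (W : Matrix l l ℂ) : ptr f (z • W) = z • ptr f W := by
  ext i j
  simp [ptr, Finset.mul_sum]

theorem Matrix.PosSemidef.ptr {W : Matrix l l ℂ} (hW : W.PosSemidef) (f : l ≃ n × r) :
    (ptr f W).PosSemidef := by
  have h : _root_.ptr f W =
      ∑ c, W.submatrix (fun i => f.symm (i, c)) (fun i => f.symm (i, c)) := by
    ext i j
    simp [_root_.ptr, Matrix.sum_apply]
  rw [h]
  exact Matrix.posSemidef_sum _ fun c _ => hW.submatrix _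

variable [Fintype l] [Fintype n]

theorem trace_ptr (f : l ≃ n × r) (W : Matrix l l ℂ) : (ptr f W).trace = W.trace := by
  simp only [Matrix.trace, Matrix.diag_apply, ptr, Matrix.of_apply, ← f.symm.sum_comp,
    Fintype.sum_prod_type]

variable [DecidableEq l] [DecidableEq n] [DecidableEq r]

/-- The embedding `x ↦ x ⊗ 1` of matrices on a tensor factor, along `f : l ≃ n × r`. -/
def ampl (f : l ≃ n × r) : Matrix n n ℂ →⋆ₐ[ℂ] Matrix l l ℂ where
  toFun x := (x ⊗ₖ (1 : Matrix r r ℂ)).submatrix f f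
  map_one' := by rw [Matrix.one_kronecker_one, Matrix.submatrix_one_equiv]
  map_mul' x y := by
    rw [Matrix.submatrix_mul_equiv, ← Matrix.mul_kronecker_mul, Matrix.one_mul]
  map_zero' := by rw [Matrix.zero_kronecker]; rfl
  map_add' x y := by rw [Matrix.add_kronecker]; rfl
  commutes' z := by
    rw [Algebra.algebraMap_eq_smul_one, Algebra.algebraMap_eq_smul_one, Matrix.smul_kronecker,
      Matrix.one_kronecker_one, Matrix.submatrix_smul, Pi.smul_apply, Pi.smul_apply,
      Matrix.submatrix_one_equiv]
  map_star' x := by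
    rw [Matrix.star_eq_conjTranspose, Matrix.star_eq_conjTranspose, Matrix.conjTranspose_submatrix,
      Matrix.conjTranspose_kronecker, Matrix.conjTranspose_one]

theorem ampl_apply (f : l ≃ n × r) (x : Matrix n n ℂ) (p q : l) :
    ampl f x p q = x (f p).1 (f q).1 * (1 : Matrix r r ℂ) (f p).2 (f q).2 := rfl

theorem ampl_conjTranspose (f : l ≃ n × r) (x : Matrix n n ℂ) : (ampl f x)ᴴ = ampl f xᴴ :=
  (map_star (ampl f) x).symm

theorem ptr_ampl_mul (f : l ≃ n × r) (x : Matrix n n ℂ) (W : Matrix l l ℂ) :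
    ptr f (ampl f x * W) = x * ptr f W := by
  ext i j
  simp only [ptr, Matrix.of_apply, Matrix.mul_apply, ampl_apply, ← f.symm.sum_comp,
    Equiv.apply_symm_apply, Fintype.sum_prod_type, Matrix.one_apply, mul_ite, mul_one, mul_zero,
    ite_mul, zero_mul, Finset.sum_ite_eq, Finset.mem_univ, if_true, Finset.mul_sum]
  exact Finset.sum_comm

theorem ptr_mul_ampl (f : l ≃ n × r) (x : Matrix n n ℂ) (W : Matrix l l ℂ) :
    ptr f (W * ampl f x) = ptr f W * x := by
  ext i j
  simp only [ptr, Matrix.of_apply, Matrix.mul_apply, ampl_apply, ← f.symm.sum_comp,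
    Equiv.apply_symm_apply, Fintype.sum_prod_type, Matrix.one_apply, mul_ite, mul_one, mul_zero,
    Finset.sum_ite_eq', Finset.mem_univ, if_true, Finset.sum_mul]
  exact Finset.sum_comm

theorem trace_ampl_mul (f : l ≃ n × r) (x : Matrix n n ℂ) (W : Matrix l l ℂ) :
    (ampl f x * W).trace = (x * ptr f W).trace := by
  rw [← ptr_ampl_mul, trace_ptr]

theorem IsDiagonalization.ampl {x u : Matrix n n ℂ} {d : n → ℝ} (h : IsDiagonalization x u d)
    (f : l ≃ n × r) : IsDiagonalization (ampl f x) (ampl f u) (fun p => d (f p).1) where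
  left := by rw [ampl_conjTranspose, ← map_mul, h.left, map_one]
  right := by rw [ampl_conjTranspose, ← map_mul, h.right, map_one]
  eq := by
    have : diagonal (fun p => (d (f p).1 : ℂ)) = _root_.ampl f (diagonal fun i => (d i : ℂ)) := by
      ext p q
      simp only [ampl_apply, Matrix.diagonal_apply, Matrix.one_apply, mul_ite, mul_one,
        mul_zero]
      by_cases hpq : p = q
      · simp [hpq]
      · have : ¬ ((f p).1 = (f q).1 ∧ (f p).2 = (f q).2) := fun h =>
          hpq (f.injective (Prod.ext h.1 h.2))
        rw [if_neg hpq]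
        split_ifs <;> tauto
    rw [this, ampl_conjTranspose, ← map_mul, ← map_mul, ← h.eq]

/-- The diagonal of a state in the product basis sums to the spectrum of its marginal. -/
theorem IsDiagonalization.sum_ampl_conj {W : Matrix l l ℂ} {f : l ≃ n × r} {u : Matrix n n ℂ}
    {d : n → ℝ} (h : IsDiagonalization (ptr f W) u d) (i : n) :
    ∑ c, (((_root_.ampl f u)ᴴ * W * _root_.ampl f u) (f.symm (i, c)) (f.symm (i, c))).re = d i := by
  have h1 : ptr f ((_root_.ampl f u)ᴴ * W * _root_.ampl f u) = diagonal fun i => (d i : ℂ) := by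
    rw [ptr_mul_ampl, ampl_conjTranspose, ptr_ampl_mul, h.conj_eq]
  have h2 := congrArg Complex.re (congrFun (congrFun h1 i) i)
  rw [Matrix.diagonal_apply_eq, Complex.ofReal_re] at h2
  rw [← h2, ptr, Matrix.of_apply, Complex.re_sum]

theorem IsDiagonalization.sum_ampl_mul {W : Matrix l l ℂ} {f : l ≃ n × r} {u : Matrix n n ℂ}
    {d : n → ℝ} (h : IsDiagonalization (ptr f W) u d) (g : n → ℝ) :
    ∑ p, (((_root_.ampl f u)ᴴ * W * _root_.ampl f u) p p).re * g (f p).1 = ∑ i, d i * g i := by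
  rw [← f.symm.sum_comp, Fintype.sum_prod_type]
  refine Finset.sum_congr rfl fun i _ => ?_
  simp only [Equiv.apply_symm_apply, ← Finset.sum_mul, h.sum_ampl_conj]

theorem IsDiagonalization.ampl_conj_eq_zero {W : Matrix l l ℂ} (hW : W.PosSemidef) {f : l ≃ n × r}
    {u : Matrix n n ℂ} {d : n → ℝ} (h : IsDiagonalization (ptr f W) u d) (p : l)
    (hp : d (f p).1 = 0) : (((_root_.ampl f u)ᴴ * W * _root_.ampl f u) p p).re = 0 := by
  rw [← h.sum_ampl_conj] at hp
  have := (Finset.sum_eq_zero_iff_of_nonneg fun c _ =>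
    (Complex.nonneg_iff.1 ((hW.conjTranspose_mul_mul_same _).diag_nonneg)).1).1 hp (f p).2
      (Finset.mem_univ _)
  simpa using this

/-- Vanishing of the conditional mutual information for two overlapping marginals is equivalent to
solvability of a family of Sylvester equations in the second marginal algebra. -/
theorem entropy_eq_iff_sylvester {k s b : Type*} [Fintype k] [DecidableEq k] [Fintype s]
    [DecidableEq s] [Fintype b] [DecidableEq b] (f : l ≃ n × r) (g : l ≃ k × s) (f₀ : k ≃ b × r)
    {W : Matrix l l ℂ} (hW : W.PosSemidef)
    (hfg : ptr g (ampl f (ptr f W)) = ampl f₀ (ptr f₀ (ptr g W))) :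
    vNEntropy (ptr f W) + vNEntropy (ptr g W) - vNEntropy (ptr f₀ (ptr g W)) - vNEntropy W = 0 ↔
      ∀ t : ℝ, 0 < t → ∃ X : Matrix k k ℂ,
        ampl f (ptr f W) * ampl g X + (t : ℂ) • (ampl g X * W) = W := by
  have hf := hW.ptr f
  have hg := hW.ptr g
  have hfg' := hg.ptr f₀
  have Df := hf.1.isDiagonalization
  have Dg := hg.1.isDiagonalization
  have Dfg := hfg'.1.isDiagonalization
  have key := relEntropy_eq_iff_sylvester (ι := ampl g) (E := ptr g) (trace_ampl_mul g)
    (Df.ampl f) hW.1.isDiagonalization (by rw [hfg]; exact Dfg.ampl f₀) Dg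
    (fun i => hf.eigenvalues_nonneg _) (fun i => hW.eigenvalues_nonneg _)
    (fun i => hfg'.eigenvalues_nonneg _) (fun i => hg.eigenvalues_nonneg _)
    (Df.ampl_conj_eq_zero hW) (Dfg.ampl_conj_eq_zero hg)
  rw [← key, Df.sum_ampl_mul fun i => Real.log (hf.1.eigenvalues i),
    Dfg.sum_ampl_mul fun i => Real.log (hfg'.1.eigenvalues i)]
  simp only [vNEntropy, dif_pos hf.1, dif_pos hg.1, dif_pos hfg'.1, dif_pos hW.1]
  constructor <;> intro h <;> linarith

end Amplification

section Tripartite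

variable {A B C : Type*} [Fintype A] [DecidableEq A] [Fintype B] [DecidableEq B] [Fintype C]
  [DecidableEq C]

/-- The embedding `x ↦ x ⊗ 1_C`. -/
abbrev liftAB : Matrix (A × B) (A × B) ℂ →⋆ₐ[ℂ] Matrix (A × B × C) (A × B × C) ℂ :=
  ampl (Equiv.prodAssoc A B C).symm

/-- The embedding `T ↦ 1_A ⊗ T`. -/
abbrev liftBC : Matrix (B × C) (B × C) ℂ →⋆ₐ[ℂ] Matrix (A × B × C) (A × B × C) ℂ :=
  ampl (Equiv.prodComm A (B × C))

/-- The embedding `b ↦ b ⊗ 1_C`. -/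
abbrev rightOne : Matrix B B ℂ →⋆ₐ[ℂ] Matrix (B × C) (B × C) ℂ :=
  ampl (Equiv.refl (B × C))

/-- The embedding `b ↦ 1_A ⊗ b`. -/
abbrev leftOne : Matrix B B ℂ →⋆ₐ[ℂ] Matrix (A × B) (A × B) ℂ :=
  ampl (Equiv.prodComm A B)

theorem liftAB_apply (x : Matrix (A × B) (A × B) ℂ) (p q : A × B × C) :
    liftAB x p q = x (p.1, p.2.1) (q.1, q.2.1) * (1 : Matrix C C ℂ) p.2.2 q.2.2 := rfl

theorem liftBC_apply (T : Matrix (B × C) (B × C) ℂ) (p q : A × B × C) :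
    liftBC T p q = T p.2 q.2 * (1 : Matrix A A ℂ) p.1 q.1 := rfl

theorem rightOne_apply (b : Matrix B B ℂ) (p q : B × C) :
    rightOne b p q = b p.1 q.1 * (1 : Matrix C C ℂ) p.2 q.2 := rfl

theorem leftOne_apply (b : Matrix B B ℂ) (p q : A × B) :
    leftOne b p q = b p.2 q.2 * (1 : Matrix A A ℂ) p.1 q.1 := rfl

theorem liftAB_leftOne (b : Matrix B B ℂ) :
    liftAB (C := C) (leftOne (A := A) b) = liftBC (rightOne b) := by
  ext p q
  rw [liftAB_apply, leftOne_apply, liftBC_apply, rightOne_apply]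
  ring

omit [DecidableEq A] [Fintype B] [DecidableEq B] [DecidableEq C] in
theorem margB_eq_ptr_margBC (W : Matrix (A × B × C) (A × B × C) ℂ) :
    margB W = ptr (Equiv.refl (B × C)) (margBC W) := by
  ext b b'
  exact Finset.sum_comm

theorem margBC_liftAB (x : Matrix (A × B) (A × B) ℂ) :
    margBC (liftAB (C := C) x) = rightOne (ptr (Equiv.prodComm A B) x) := by
  ext p q
  simp only [margBC, ptr, Matrix.of_apply, ampl_apply, Finset.sum_mul]
  rfl

theorem margAB_liftBC (T : Matrix (B × C) (B × C) ℂ) :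
    margAB (liftBC (A := A) T) = leftOne (ptr (Equiv.refl (B × C)) T) := by
  ext p q
  simp only [margAB, ptr, Matrix.of_apply, ampl_apply, Finset.sum_mul]
  rfl

theorem margAB_liftAB_mul (x : Matrix (A × B) (A × B) ℂ) (W : Matrix (A × B × C) (A × B × C) ℂ) :
    margAB (liftAB x * W) = x * margAB W := ptr_ampl_mul _ _ _

theorem margAB_mul_liftAB (x : Matrix (A × B) (A × B) ℂ) (W : Matrix (A × B × C) (A × B × C) ℂ) :
    margAB (W * liftAB x) = margAB W * x := ptr_mul_ampl _ _ _

theorem margBC_liftBC_mul (x : Matrix (B × C) (B × C) ℂ) (W : Matrix (A × B × C) (A × B × C) ℂ) :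
    margBC (liftBC x * W) = x * margBC W := ptr_ampl_mul _ _ _

theorem margBC_mul_liftBC (x : Matrix (B × C) (B × C) ℂ) (W : Matrix (A × B × C) (A × B × C) ℂ) :
    margBC (W * liftBC x) = margBC W * x := ptr_mul_ampl _ _ _

theorem CMI_eq_zero_iff_sylvester_BC {W : Matrix (A × B × C) (A × B × C) ℂ}
    (hW : W.PosSemidef) :
    CMI W = 0 ↔ ∀ t : ℝ, 0 < t → ∃ X : Matrix (B × C) (B × C) ℂ,
      liftAB (margAB W) * liftBC X + (t : ℂ) • (liftBC X * W) = W := by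
  have h := entropy_eq_iff_sylvester (Equiv.prodAssoc A B C).symm (Equiv.prodComm A (B × C))
    (Equiv.refl (B × C)) hW
    ((margBC_liftAB (margAB W)).trans (congrArg rightOne (margB_eq_ptr_margBC W)))
  refine Iff.trans ?_ h
  rw [CMI, margB_eq_ptr_margBC]
  rfl

theorem CMI_eq_zero_iff_sylvester_AB {W : Matrix (A × B × C) (A × B × C) ℂ}
    (hW : W.PosSemidef) :
    CMI W = 0 ↔ ∀ t : ℝ, 0 < t → ∃ Y : Matrix (A × B) (A × B) ℂ,
      liftBC (margBC W) * liftAB Y + (t : ℂ) • (liftAB Y * W) = W := by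
  have h := entropy_eq_iff_sylvester (Equiv.prodComm A (B × C)) (Equiv.prodAssoc A B C).symm
    (Equiv.prodComm A B) hW
    ((margAB_liftBC (margBC W)).trans (congrArg leftOne (margB_eq_ptr_margBC W).symm))
  refine Iff.trans ?_ h
  rw [CMI, add_comm (vNEntropy (margAB W))]
  rfl

/-- The `B`-block of an operator on `A ⊗ B ⊗ C`. -/
abbrev slice (W : Matrix (A × B × C) (A × B × C) ℂ) (a a' : A) (c c' : C) : Matrix B B ℂ :=
  W.submatrix (fun b => (a, b, c)) (fun b => (a', b, c'))

/-- The `B`-block of an operator on `A ⊗ B`. -/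
abbrev sliceA (x : Matrix (A × B) (A × B) ℂ) (a a' : A) : Matrix B B ℂ :=
  x.submatrix (fun b => (a, b)) (fun b => (a', b))

/-- The `B`-block of an operator on `B ⊗ C`. -/
abbrev sliceC (T : Matrix (B × C) (B × C) ℂ) (c c' : C) : Matrix B B ℂ :=
  T.submatrix (fun b => (b, c)) (fun b => (b, c'))

theorem slice_liftAB_mul (x : Matrix (A × B) (A × B) ℂ) (W : Matrix (A × B × C) (A × B × C) ℂ)
    (a a' : A) (c c' : C) :
    slice (liftAB x * W) a a' c c' = ∑ a'', sliceA x a a'' * slice W a'' a' c c' := by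
  ext b b'
  simp only [Matrix.submatrix_apply, Matrix.mul_apply, Matrix.sum_apply, liftAB_apply,
    Fintype.sum_prod_type, Matrix.one_apply, mul_ite, mul_one,
    mul_zero, ite_mul, zero_mul, Finset.sum_ite_eq, Finset.mem_univ, if_true]

theorem slice_mul_liftAB (x : Matrix (A × B) (A × B) ℂ) (W : Matrix (A × B × C) (A × B × C) ℂ)
    (a a' : A) (c c' : C) :
    slice (W * liftAB x) a a' c c' = ∑ a'', slice W a a'' c c' * sliceA x a'' a' := by
  ext b b'
  simp only [Matrix.submatrix_apply, Matrix.mul_apply, Matrix.sum_apply, liftAB_apply,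
    Fintype.sum_prod_type, Matrix.one_apply, mul_ite, mul_one,
    mul_zero, Finset.sum_ite_eq', Finset.mem_univ, if_true]

theorem slice_liftBC_mul (T : Matrix (B × C) (B × C) ℂ) (W : Matrix (A × B × C) (A × B × C) ℂ)
    (a a' : A) (c c' : C) :
    slice (liftBC T * W) a a' c c' = ∑ c'', sliceC T c c'' * slice W a a' c'' c' := by
  ext b b'
  simp only [Matrix.submatrix_apply, Matrix.mul_apply, Matrix.sum_apply, liftBC_apply,
    Fintype.sum_prod_type, Matrix.one_apply, mul_ite, mul_one, mul_zero, ite_mul, zero_mul]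
  rw [Finset.sum_eq_single a, Finset.sum_comm]
  · simp
  · intro a'' _ h
    simp [h.symm]
  · simp

theorem slice_liftAB_mul_liftBC (x : Matrix (A × B) (A × B) ℂ) (T : Matrix (B × C) (B × C) ℂ)
    (a a' : A) (c c' : C) :
    slice (liftAB x * liftBC T) a a' c c' = sliceA x a a' * sliceC T c c' := by
  rw [slice_liftAB_mul, Finset.sum_eq_single a']
  · congr 1
    ext b b'
    simp [liftBC_apply]
  · intro a'' _ h
    have : slice (liftBC T) a'' a' c c' = 0 := by
      ext b b'
      simp [liftBC_apply, h]
    rw [this, Matrix.mul_zero]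
  · simp

theorem slice_liftBC_mul_liftAB (x : Matrix (A × B) (A × B) ℂ) (T : Matrix (B × C) (B × C) ℂ)
    (a a' : A) (c c' : C) :
    slice (liftBC T * liftAB x) a a' c c' = sliceC T c c' * sliceA x a a' := by
  rw [slice_mul_liftAB, Finset.sum_eq_single a]
  · congr 1
    ext b b'
    simp [liftBC_apply]
  · intro a'' _ h
    have : slice (liftBC T) a a'' c c' = 0 := by
      ext b b'
      simp [liftBC_apply, h.symm]
    rw [this, Matrix.zero_mul]
  · simp

end Tripartite

section StarAlgebra

variable {B : Type*} [Fintype B] [DecidableEq B]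

/-- A minimal projection of a star-algebra of matrices. -/
structure IsMinimalProjection (N : StarSubalgebra ℂ (Matrix B B ℂ)) (e : Matrix B B ℂ) : Prop where
  mem : e ∈ N
  herm : eᴴ = e
  idem : e * e = e
  ne_zero : e ≠ 0
  minimal : ∀ x ∈ N, ∃ z : ℂ, e * x * e = z • e

theorem IsDiagonalization.commute_of_commute {h V : Matrix B B ℂ} {d : B → ℝ}
    (hV : IsDiagonalization h V d) (f : ℝ → ℂ) {s : Matrix B B ℂ} (hs : s * h = h * s) :
    s * (V * diagonal (fun i => f (d i)) * Vᴴ) = V * diagonal (fun i => f (d i)) * Vᴴ * s := by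
  have h1 : (Vᴴ * s * V) * diagonal (fun i => (d i : ℂ)) =
      diagonal (fun i => (d i : ℂ)) * (Vᴴ * s * V) := by
    rw [← hV.conj_eq]
    calc _ = Vᴴ * s * (V * Vᴴ) * h * V := by simp only [Matrix.mul_assoc]
      _ = Vᴴ * (s * h) * V := by simp only [hV.right, Matrix.mul_one, Matrix.mul_assoc]
      _ = Vᴴ * h * (V * Vᴴ) * s * V := by
        rw [hs, hV.right]; simp only [Matrix.mul_one, Matrix.mul_assoc]
      _ = _ := by simp only [Matrix.mul_assoc]
  have h2 : (Vᴴ * s * V) * diagonal (fun i => f (d i)) =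
      diagonal (fun i => f (d i)) * (Vᴴ * s * V) := by
    ext i j
    have h3 := congrFun (congrFun h1 i) j
    rw [Matrix.mul_diagonal, Matrix.diagonal_mul] at h3 ⊢
    by_cases hij : d i = d j
    · rw [hij, mul_comm]
    · have h4 : (Vᴴ * s * V) i j * ((d j : ℂ) - d i) = 0 := by linear_combination h3
      have h5 : (Vᴴ * s * V) i j = 0 := (mul_eq_zero.1 h4).resolve_right fun h6 =>
        hij (by exact_mod_cast (sub_eq_zero.1 h6).symm)
      rw [h5, zero_mul, mul_zero]
  calc _ = V * ((Vᴴ * s * V) * diagonal (fun i => f (d i))) * Vᴴ := by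
        simp only [← Matrix.mul_assoc, hV.right, Matrix.one_mul]
    _ = V * diagonal (fun i => f (d i)) * Vᴴ * s * (V * Vᴴ) := by
        rw [h2]; simp only [Matrix.mul_assoc]
    _ = _ := by rw [hV.right, Matrix.mul_one]

theorem exists_hermitian_of_not_minimal {N : StarSubalgebra ℂ (Matrix B B ℂ)} {p : Matrix B B ℂ}
    (hp : p ∈ N) (hherm : pᴴ = p) (hidem : p * p = p)
    (hmin : ¬ ∀ x ∈ N, ∃ z : ℂ, p * x * p = z • p) :
    ∃ h ∈ N, hᴴ = h ∧ p * h = h ∧ h * p = h ∧ ∀ z : ℂ, h ≠ z • p := by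
  by_contra hcon
  push Not at hcon
  refine hmin fun x hx => ?_
  have hy : p * x * p ∈ N := mul_mem (mul_mem hp hx) hp
  have hy' : (p * x * p)ᴴ ∈ N := star_mem hy
  have hc : (p * x * p)ᴴ = p * xᴴ * p := by
    simp only [Matrix.conjTranspose_mul, hherm, Matrix.mul_assoc]
  have l1 : ∀ M, p * (p * M * p) = p * M * p := fun M => by
    rw [← Matrix.mul_assoc, ← Matrix.mul_assoc, hidem]
  have l2 : ∀ M, (p * M * p) * p = p * M * p := fun M => by rw [Matrix.mul_assoc, hidem]
  obtain ⟨z₁, h₁⟩ := hcon (p * x * p + (p * x * p)ᴴ) (add_mem hy hy')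
    (by rw [Matrix.conjTranspose_add, Matrix.conjTranspose_conjTranspose, add_comm])
    (by rw [hc, Matrix.mul_add, l1, l1]) (by rw [hc, Matrix.add_mul, l2, l2])
  obtain ⟨z₂, h₂⟩ := hcon (Complex.I • (p * x * p - (p * x * p)ᴴ))
    (SMulMemClass.smul_mem _ (sub_mem hy hy'))
    (by
      rw [Matrix.conjTranspose_smul, Matrix.conjTranspose_sub, Matrix.conjTranspose_conjTranspose,
        RCLike.star_def, Complex.conj_I, neg_smul, ← smul_neg, neg_sub])
    (by rw [hc, Matrix.mul_smul, Matrix.mul_sub, l1, l1])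
    (by rw [hc, Matrix.smul_mul, Matrix.sub_mul, l2, l2])
  refine ⟨(z₁ - Complex.I * z₂) / 2, ?_⟩
  rw [sub_div, sub_smul, div_eq_inv_mul, div_eq_inv_mul, mul_smul, mul_smul, mul_smul, ← h₁, ← h₂,
    smul_smul Complex.I Complex.I, Complex.I_mul_I]
  module

/-- A projection of a star-algebra of matrices which is not minimal splits. -/
theorem exists_split_of_not_minimal (S : Set (Matrix B B ℂ)) {p : Matrix B B ℂ}
    (hp : p ∈ StarSubalgebra.centralizer ℂ S) (hherm : pᴴ = p) (hidem : p * p = p)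
    (hp0 : p ≠ 0)
    (hmin : ¬ ∀ x ∈ StarSubalgebra.centralizer ℂ S, ∃ z : ℂ, p * x * p = z • p) :
    ∃ q ∈ StarSubalgebra.centralizer ℂ S,
      qᴴ = q ∧ q * q = q ∧ p * q = q ∧ q * p = q ∧ q ≠ 0 ∧ q ≠ p := by
  obtain ⟨h, hh, hhh, hph, hhp, hz⟩ := exists_hermitian_of_not_minimal hp hherm hidem hmin
  have hV := Matrix.IsHermitian.isDiagonalization hhh
  set V : Matrix B B ℂ := (Matrix.IsHermitian.eigenvectorUnitary hhh : Matrix B B ℂ)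
  set d := Matrix.IsHermitian.eigenvalues hhh
  have hpV : p * V ≠ 0 := fun h0 => hp0 (by
    rw [← Matrix.mul_one p, ← hV.right, ← Matrix.mul_assoc, h0, Matrix.zero_mul])
  obtain ⟨b, i, hbi⟩ : ∃ b i, (p * V) b i ≠ 0 := by
    by_contra hcon
    push Not at hcon
    exact hpV (by ext b i; exact hcon b i)
  set f : ℝ → ℂ := fun x => if x = d i then 1 else 0 with hf
  set Q := V * diagonal (fun j => f (d j)) * Vᴴ with hQ
  have hcomm : ∀ s, s * h = h * s → s * Q = Q * s := fun s hs => hV.commute_of_commute f hs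
  have hQN : Q ∈ StarSubalgebra.centralizer ℂ S := by
    rw [StarSubalgebra.mem_centralizer_iff] at hh ⊢
    exact fun g hg => ⟨hcomm g (hh g hg).1, hcomm (star g) (hh g hg).2⟩
  have hpQ : p * Q = Q * p := hcomm p (hph.trans hhp.symm)
  have hff : ∀ x, f x * f x = f x := fun x => by
    rw [hf]; dsimp only; split_ifs <;> simp
  have hQQ : Q * Q = Q := by
    calc Q * Q = V * diagonal (fun j => f (d j)) * (Vᴴ * V) * diagonal (fun j => f (d j)) * Vᴴ := by
          rw [hQ]; simp only [Matrix.mul_assoc]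
      _ = V * (diagonal (fun j => f (d j)) * diagonal (fun j => f (d j))) * Vᴴ := by
          rw [hV.left]; simp only [Matrix.mul_one, Matrix.mul_assoc]
      _ = Q := by rw [Matrix.diagonal_mul_diagonal]; simp only [hff, hQ]
  have hQh : Qᴴ = Q := by
    have : star (fun j => f (d j)) = fun j => f (d j) := by
      funext j
      simp only [Pi.star_apply, hf]
      split_ifs <;> simp
    rw [hQ, Matrix.conjTranspose_mul, Matrix.conjTranspose_mul, Matrix.conjTranspose_conjTranspose,
      Matrix.diagonal_conjTranspose, this, Matrix.mul_assoc]
  have hhQ : h * Q = (d i : ℂ) • Q := by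
    calc h * Q = V * diagonal (fun j => (d j : ℂ)) * (Vᴴ * V) * diagonal (fun j => f (d j)) * Vᴴ := by
          rw [hQ]; nth_rewrite 1 [hV.eq]; simp only [Matrix.mul_assoc]
      _ = V * (diagonal (fun j => (d j : ℂ)) * diagonal (fun j => f (d j))) * Vᴴ := by
          rw [hV.left]; simp only [Matrix.mul_one, Matrix.mul_assoc]
      _ = V * ((d i : ℂ) • diagonal (fun j => f (d j))) * Vᴴ := by
          congr 2
          rw [Matrix.diagonal_mul_diagonal, ← Matrix.diagonal_smul]
          congr 1
          funext j
          simp only [hf, Pi.smul_apply, smul_eq_mul]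
          split_ifs with h0
          · rw [h0]
          · simp
      _ = _ := by rw [Matrix.mul_smul, Matrix.smul_mul]
  refine ⟨p * Q, mul_mem hp hQN, ?_, ?_, ?_, ?_, ?_, ?_⟩
  · rw [Matrix.conjTranspose_mul, hherm, hQh, hpQ]
  · rw [Matrix.mul_assoc, ← Matrix.mul_assoc Q, ← hpQ, Matrix.mul_assoc, hQQ, ← Matrix.mul_assoc,
      hidem]
  · rw [← Matrix.mul_assoc, hidem]
  · rw [hpQ, Matrix.mul_assoc, hidem]
  · intro h0
    apply hbi
    have h1 : p * Q * V = p * V * diagonal (fun j => f (d j)) := by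
      rw [hQ]
      calc _ = p * V * diagonal (fun j => f (d j)) * (Vᴴ * V) := by simp only [Matrix.mul_assoc]
        _ = _ := by rw [hV.left, Matrix.mul_one]
    have h2 := congrFun (congrFun h1 b) i
    rw [h0, Matrix.zero_mul, Matrix.mul_diagonal, hf] at h2
    simpa using h2.symm
  · intro h0
    apply hz (d i : ℂ)
    rw [← h0, hpQ, ← Matrix.smul_mul, ← hhQ, Matrix.mul_assoc, ← hpQ, h0, hhp]

/-- Every projection is a finite orthogonal sum of minimal projections. -/
theorem exists_minimalProjections (S : Set (Matrix B B ℂ)) (p : Matrix B B ℂ)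
    (hp : p ∈ StarSubalgebra.centralizer ℂ S) (hherm : pᴴ = p) (hidem : p * p = p) :
    ∃ s : Finset (Matrix B B ℂ),
      (∀ e ∈ s, IsMinimalProjection (StarSubalgebra.centralizer ℂ S) e) ∧
      (∀ e ∈ s, ∀ f ∈ s, e ≠ f → e * f = 0) ∧ ∑ e ∈ s, e = p := by
  classical
  generalize hR : LinearMap.range p.mulVecLin = R
  induction R using WellFoundedLT.induction generalizing p with
  | ind R ih =>
  subst hR
  by_cases hp0 : p = 0
  · exact ⟨∅, by simp, by simp, by simp [hp0]⟩
  by_cases hmin : ∀ x ∈ StarSubalgebra.centralizer ℂ S, ∃ z : ℂ, p * x * p = z • p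
  · exact ⟨{p}, by simpa using ⟨hp, hherm, hidem, hp0, hmin⟩, by simp, by simp⟩
  obtain ⟨q, hq, hqh, hqq, hpq, hqp, hq0, hqne⟩ :=
    exists_split_of_not_minimal S hp hherm hidem hp0 hmin
  have hlt : ∀ r : Matrix B B ℂ, r * r = r → p * r = r → r * p = r → r ≠ p →
      LinearMap.range r.mulVecLin < LinearMap.range p.mulVecLin := by
    intro r hrr hpr hrp hne
    refine lt_of_le_not_ge ?_ fun hle => hne ?_
    · rintro _ ⟨v, rfl⟩
      exact ⟨r *ᵥ v, by simp [Matrix.mulVec_mulVec, hpr]⟩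
    · rw [← hrp]
      refine Matrix.ext_of_mulVec_single fun i => ?_
      obtain ⟨w, hw⟩ := hle ⟨Pi.single i 1, rfl⟩
      simp only [Matrix.mulVecLin_apply] at hw
      rw [← Matrix.mulVec_mulVec, ← hw, Matrix.mulVec_mulVec, hrr]
  obtain ⟨s, hs1, hs2, hs3⟩ := ih _ (hlt q hqq hpq hqp hqne) q hq hqh hqq rfl
  have hr : (p - q) * (p - q) = p - q := by
    rw [Matrix.sub_mul, Matrix.mul_sub, Matrix.mul_sub, hidem, hpq, hqp, hqq, sub_self, sub_zero]
  obtain ⟨s', hs1', hs2', hs3'⟩ := ih _ (hlt (p - q) hr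
    (by rw [Matrix.mul_sub, hidem, hpq]) (by rw [Matrix.sub_mul, hidem, hqp])
    (by simpa using hq0)) (p - q) (sub_mem hp hq)
    (by rw [Matrix.conjTranspose_sub, hherm, hqh]) hr rfl
  have absorb : ∀ (u : Finset (Matrix B B ℂ)) (r : Matrix B B ℂ),
      (∀ e ∈ u, e * e = e) → (∀ e ∈ u, ∀ f ∈ u, e ≠ f → e * f = 0) → ∑ e ∈ u, e = r →
      ∀ e ∈ u, e * r = e ∧ r * e = e := by
    intro u r h1 h2 h3 e he
    rw [← h3, Finset.mul_sum, Finset.sum_mul]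
    constructor
    · rw [Finset.sum_eq_single_of_mem e he fun f hf hne => h2 e he f hf hne.symm, h1 e he]
    · rw [Finset.sum_eq_single_of_mem e he fun f hf hne => h2 f hf e he hne, h1 e he]
  have hA := absorb s q (fun e he => (hs1 e he).idem) hs2 hs3
  have hA' := absorb s' (p - q) (fun e he => (hs1' e he).idem) hs2' hs3'
  have hz : q * (p - q) = 0 := by rw [Matrix.mul_sub, hqp, hqq, sub_self]
  have hz' : (p - q) * q = 0 := by rw [Matrix.sub_mul, hpq, hqq, sub_self]
  have ho : ∀ e ∈ s, ∀ f ∈ s', e * f = 0 := fun e he f hf => by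
    rw [← (hA e he).1, ← (hA' f hf).2, Matrix.mul_assoc, ← Matrix.mul_assoc q, hz,
      Matrix.zero_mul, Matrix.mul_zero]
  have ho' : ∀ e ∈ s, ∀ f ∈ s', f * e = 0 := fun e he f hf => by
    rw [← (hA e he).2, ← (hA' f hf).1, Matrix.mul_assoc, ← Matrix.mul_assoc (p - q), hz',
      Matrix.zero_mul, Matrix.mul_zero]
  have hdisj : Disjoint s s' := Finset.disjoint_left.2 fun e he he' =>
    (hs1 e he).ne_zero (by rw [← (hs1 e he).idem, ho e he e he'])
  refine ⟨s ∪ s', ?_, ?_, ?_⟩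
  · intro e he
    exact (Finset.mem_union.1 he).elim (hs1 e) (hs1' e)
  · intro e he f hf hne
    rcases Finset.mem_union.1 he with he | he <;> rcases Finset.mem_union.1 hf with hf | hf
    · exact hs2 e he f hf hne
    · exact ho e he f hf
    · exact ho' f hf e he
    · exact hs2' e he f hf hne
  · rw [Finset.sum_union hdisj, hs3, hs3', add_sub_cancel]

end StarAlgebra

section StructureTheorem

variable {B : Type*} [Fintype B] [DecidableEq B]

/-- Equivalence of projections through a partial isometry of the algebra. -/
def ProjEquiv (N : StarSubalgebra ℂ (Matrix B B ℂ)) (e f : Matrix B B ℂ) : Prop :=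
  ∃ v ∈ N, vᴴ * v = f ∧ v * vᴴ = e ∧ v * f = v

theorem ProjEquiv.refl {N : StarSubalgebra ℂ (Matrix B B ℂ)} {e : Matrix B B ℂ}
    (he : IsMinimalProjection N e) : ProjEquiv N e e :=
  ⟨e, he.mem, by rw [he.herm, he.idem], by rw [he.herm, he.idem], he.idem⟩

theorem ProjEquiv.symm {N : StarSubalgebra ℂ (Matrix B B ℂ)} {e f : Matrix B B ℂ}
    (h : ProjEquiv N e f) : ProjEquiv N f e := by
  obtain ⟨v, hv, h1, h2, h3⟩ := h
  refine ⟨vᴴ, star_mem hv, ?_, ?_, ?_⟩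
  · rw [Matrix.conjTranspose_conjTranspose, h2]
  · rw [Matrix.conjTranspose_conjTranspose, h1]
  · have hf : fᴴ = f := by rw [← h1, Matrix.conjTranspose_mul, Matrix.conjTranspose_conjTranspose]
    rw [← h2, ← Matrix.mul_assoc, h1]
    conv_rhs => rw [← h3, Matrix.conjTranspose_mul, hf]

theorem ProjEquiv.trans {N : StarSubalgebra ℂ (Matrix B B ℂ)} {e f g : Matrix B B ℂ}
    (hg : g * g = g)
    (h : ProjEquiv N e f) (h' : ProjEquiv N f g) : ProjEquiv N e g := by
  obtain ⟨v, hv, h1, h2, h3⟩ := h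
  obtain ⟨w, hw, k1, k2, k3⟩ := h'
  refine ⟨v * w, mul_mem hv hw, ?_, ?_, ?_⟩
  · calc (v * w)ᴴ * (v * w) = wᴴ * (vᴴ * v) * w := by
          rw [Matrix.conjTranspose_mul]; simp only [Matrix.mul_assoc]
      _ = (wᴴ * w) * (wᴴ * w) := by rw [h1, ← k2]; simp only [Matrix.mul_assoc]
      _ = g := by rw [k1, hg]
  · calc (v * w) * (v * w)ᴴ = v * (w * wᴴ) * vᴴ := by
          rw [Matrix.conjTranspose_mul]; simp only [Matrix.mul_assoc]
      _ = e := by rw [k2, h3, h2]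
  · rw [Matrix.mul_assoc, k3]

theorem projEquiv_of_ne_zero {N : StarSubalgebra ℂ (Matrix B B ℂ)} {e f x : Matrix B B ℂ}
    (he : IsMinimalProjection N e) (hf : IsMinimalProjection N f) (hx : x ∈ N)
    (h : e * x * f ≠ 0) : ProjEquiv N e f := by
  set w := e * x * f with hw
  have hwN : w ∈ N := mul_mem (mul_mem he.mem hx) hf.mem
  have hwf : w * f = w := by rw [hw, Matrix.mul_assoc, hf.idem]
  have hew : e * w = w := by rw [hw, ← Matrix.mul_assoc, ← Matrix.mul_assoc, he.idem]
  have hwe : wᴴ * e = wᴴ := by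
    have := congrArg Matrix.conjTranspose hew
    rwa [Matrix.conjTranspose_mul, he.herm] at this
  have hfw : f * wᴴ = wᴴ := by
    have := congrArg Matrix.conjTranspose hwf
    rwa [Matrix.conjTranspose_mul, hf.herm] at this
  obtain ⟨z, hz⟩ := hf.minimal (wᴴ * w) (mul_mem (star_mem hwN) hwN)
  rw [← Matrix.mul_assoc, hfw, Matrix.mul_assoc, hwf] at hz
  obtain ⟨y, hy⟩ := he.minimal (w * wᴴ) (mul_mem hwN (star_mem hwN))
  rw [← Matrix.mul_assoc, hew, Matrix.mul_assoc, hwe] at hy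
  have hyz : y = z := by
    have h1 : w * wᴴ * w = y • w := by rw [hy, Matrix.smul_mul, hew]
    have h2 : w * wᴴ * w = z • w := by rw [Matrix.mul_assoc, hz, Matrix.mul_smul, hwf]
    exact smul_left_injective ℂ h (h1.symm.trans h2)
  have hfp : f.PosSemidef := by
    rw [← hf.idem]; nth_rewrite 1 [← hf.herm]; exact Matrix.posSemidef_conjTranspose_mul_self f
  have hft : 0 < f.trace := hfp.trace_nonneg.lt_of_ne' fun h0 =>
    hf.ne_zero (hfp.trace_eq_zero_iff.1 h0)
  have hwt : 0 < (wᴴ * w).trace :=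
    (Matrix.posSemidef_conjTranspose_mul_self w).trace_nonneg.lt_of_ne' fun h0 =>
      h (Matrix.trace_conjTranspose_mul_self_eq_zero_iff.1 h0)
  have hzpos : 0 < z := by
    rw [hz, Matrix.trace_smul, smul_eq_mul] at hwt
    have h1 : z = (z * f.trace) * (f.trace)⁻¹ := by
      rw [mul_assoc, mul_inv_cancel₀ hft.ne', mul_one]
    rw [h1]
    exact mul_pos hwt (inv_pos.2 hft)
  obtain ⟨hzr, hzi⟩ := Complex.pos_iff.1 hzpos
  have hzc : z = (z.re : ℂ) := Complex.ext rfl (by simpa using hzi.symm)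
  set c : ℂ := (((Real.sqrt z.re)⁻¹ : ℝ) : ℂ) with hc
  have hcc : star c * c * z = 1 := by
    rw [hc, RCLike.star_def, Complex.conj_ofReal, hzc, ← Complex.ofReal_mul, ← Complex.ofReal_mul,
      Complex.ofReal_re, ← mul_inv, Real.mul_self_sqrt hzr.le, inv_mul_cancel₀ hzr.ne',
      Complex.ofReal_one]
  refine ⟨c • w, SMulMemClass.smul_mem _ hwN, ?_, ?_, ?_⟩
  · rw [Matrix.conjTranspose_smul, Matrix.smul_mul, Matrix.mul_smul, smul_smul, hz, smul_smul, hcc,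
      one_smul]
  · rw [Matrix.conjTranspose_smul, Matrix.smul_mul, Matrix.mul_smul, smul_smul, hy, smul_smul, hyz,
      mul_comm c, hcc, one_smul]
  · rw [Matrix.smul_mul, hwf]

/-- The minimal projections of a commutant, grouped into equivalence classes. -/
theorem exists_matrixUnits (S : Set (Matrix B B ℂ)) :
    ∃ (m : ℕ) (dR : Fin m → ℕ) (e : Fin m → Matrix B B ℂ)
      (v : ∀ j, Fin (dR j) → Matrix B B ℂ),
      (∀ j, 0 < dR j) ∧
      (∀ j, IsMinimalProjection (StarSubalgebra.centralizer ℂ S) (e j)) ∧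
      (∀ j r, v j r ∈ StarSubalgebra.centralizer ℂ S) ∧
      (∀ j r, v j r * e j = v j r) ∧
      (∀ j r r', (v j r)ᴴ * v j r' = if r = r' then e j else 0) ∧
      (∑ j, ∑ r, v j r * (v j r)ᴴ = 1) ∧
      (∀ j k, j ≠ k → ∀ x ∈ StarSubalgebra.centralizer ℂ S, e j * x * e k = 0) := by
  classical
  set N := StarSubalgebra.centralizer ℂ S
  obtain ⟨s, hs1, hs2, hs3⟩ := exists_minimalProjections S 1 (one_mem _)
    Matrix.conjTranspose_one (Matrix.one_mul 1)
  let R : Setoid s :=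
    { r := fun e f => ProjEquiv N e.1 f.1
      iseqv := ⟨fun e => ProjEquiv.refl (hs1 e.1 e.2), ProjEquiv.symm, fun {_ _ g} =>
        ProjEquiv.trans (hs1 g.1 g.2).idem⟩ }
  let φ := (Fintype.equivFin (Quotient R)).symm
  let rep : Fin (Fintype.card (Quotient R)) → s := fun j => (φ j).out
  let dR : Fin (Fintype.card (Quotient R)) → ℕ := fun j =>
    Fintype.card {e : s // Quotient.mk R e = φ j}
  let idx : ∀ j, Fin (dR j) ≃ {e : s // Quotient.mk R e = φ j} := fun j =>
    (Fintype.equivFin _).symm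
  have hv : ∀ j (r : Fin (dR j)), ProjEquiv N (idx j r).1.1 (rep j).1 := fun j r =>
    Quotient.exact (s := R) ((idx j r).2.trans (Quotient.out_eq _).symm)
  choose v hvN hv1 hv2 hv3 using hv
  have hEv : ∀ j r, (idx j r).1.1 * v j r = v j r := fun j r => by
    rw [← hv2, Matrix.mul_assoc, hv1, hv3]
  refine ⟨_, dR, fun j => (rep j).1, v, ?_, fun j => hs1 _ (rep j).2, hvN, hv3, ?_, ?_, ?_⟩
  · intro j
    exact Fintype.card_pos_iff.2 ⟨⟨rep j, Quotient.out_eq _⟩⟩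
  · intro j r r'
    split_ifs with h
    · rw [h, hv1]
    · have hne : (idx j r).1.1 ≠ (idx j r').1.1 := fun h0 =>
        h ((idx j).injective (Subtype.ext (Subtype.ext h0)))
      rw [← hEv j r, ← hEv j r', Matrix.conjTranspose_mul, (hs1 _ (idx j r).1.2).herm,
        Matrix.mul_assoc, ← Matrix.mul_assoc (idx j r).1.1,
        hs2 _ (idx j r).1.2 _ (idx j r').1.2 hne, Matrix.zero_mul, Matrix.mul_zero]
  · simp only [hv2]
    rw [← hs3, ← Finset.sum_coe_sort s, ← Finset.sum_fiberwise Finset.univ (Quotient.mk R),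
      ← φ.sum_comp]
    refine Finset.sum_congr rfl fun j _ => ?_
    rw [(idx j).sum_comp fun e => e.1.1]
    exact (Finset.sum_subtype _ (by simp) fun e : s => e.1).symm
  · intro j k hjk x hx
    by_contra h
    have h1 := projEquiv_of_ne_zero (hs1 _ (rep j).2) (hs1 _ (rep k).2) hx h
    have h2 : Quotient.mk R (rep j) = Quotient.mk R (rep k) := Quotient.sound (s := R) h1
    rw [Quotient.out_eq, Quotient.out_eq] at h2
    exact hjk (φ.injective h2)

/-- A projection factors through an isometry. -/
theorem exists_isometry_of_projection {e : Matrix B B ℂ} (hherm : eᴴ = e) (hidem : e * e = e)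
    (h0 : e ≠ 0) :
    ∃ (d : ℕ) (F : Matrix B (Fin d) ℂ), 0 < d ∧ Fᴴ * F = 1 ∧ F * Fᴴ = e := by
  classical
  have hV := Matrix.IsHermitian.isDiagonalization hherm
  set V : Matrix B B ℂ := (Matrix.IsHermitian.eigenvectorUnitary hherm : Matrix B B ℂ)
  set d := Matrix.IsHermitian.eigenvalues hherm
  have hd : ∀ i, (d i : ℂ) = if d i ≠ 0 then 1 else 0 := by
    have h1 : diagonal (fun i => (d i : ℂ)) * diagonal (fun i => (d i : ℂ)) =
        diagonal (fun i => (d i : ℂ)) := by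
      nth_rewrite 1 [← hV.conj_eq]
      nth_rewrite 1 [← hV.conj_eq]
      rw [← hV.conj_eq]
      calc _ = Vᴴ * e * (V * Vᴴ) * e * V := by simp only [Matrix.mul_assoc]
        _ = Vᴴ * (e * e) * V := by rw [hV.right]; simp only [Matrix.mul_one, Matrix.mul_assoc]
        _ = _ := by rw [hidem]
    intro i
    have h2 := congrFun (congrFun h1 i) i
    rw [Matrix.diagonal_mul_diagonal, Matrix.diagonal_apply_eq, Matrix.diagonal_apply_eq] at h2
    split_ifs with h
    · exact mul_left_cancel₀ (by exact_mod_cast h) (h2.trans (mul_one _).symm)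
    · push Not at h
      simp [h]
  let idx := (Fintype.equivFin {i // d i ≠ 0}).symm
  have key : V.submatrix id (fun l => (idx l).1) * (V.submatrix id fun l => (idx l).1)ᴴ = e := by
    refine Eq.trans ?_ hV.eq.symm
    ext b b'
    have h1 : (V.submatrix id (fun l => (idx l).1) * (V.submatrix id fun l => (idx l).1)ᴴ) b b' =
        ∑ i : {i // d i ≠ 0}, V b i.1 * star (V b' i.1) :=
      idx.sum_comp fun i : {i // d i ≠ 0} => V b i.1 * star (V b' i.1)
    rw [h1, Matrix.mul_apply]
    simp only [Matrix.mul_diagonal, Matrix.conjTranspose_apply]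
    simp_rw [hd, mul_ite, ite_mul, mul_one, mul_zero, zero_mul]
    rw [← Finset.sum_filter]
    exact (Finset.sum_subtype _ (by simp) fun i => V b i * star (V b' i)).symm
  refine ⟨_, V.submatrix id fun l => (idx l).1, ?_, ?_, key⟩
  · rw [Nat.pos_iff_ne_zero]
    intro hz
    apply h0
    rw [← key]
    have : IsEmpty (Fin (Fintype.card {i // d i ≠ 0})) := by rw [hz]; infer_instance
    ext b b'
    simp [Matrix.mul_apply]
  · ext l l'
    have h1 := congrFun (congrFun hV.left (idx l).1) (idx l').1
    rw [Matrix.mul_apply] at h1 ⊢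
    refine h1.trans ?_
    simp [Matrix.one_apply, Subtype.ext_iff.symm]

end StructureTheorem

section BlockForm

variable {B : Type*} [Fintype B] [DecidableEq B] {m : ℕ} {dL dR : Fin m → ℕ}

/-- The operator `U (⊕ⱼ Lⱼ ⊗ Rⱼ) Uᴴ`. -/
noncomputable def blockForm (U : Matrix B (Σ j : Fin m, Fin (dL j) × Fin (dR j)) ℂ)
    (L : ∀ j, Matrix (Fin (dL j)) (Fin (dL j)) ℂ) (R : ∀ j, Matrix (Fin (dR j)) (Fin (dR j)) ℂ) :
    Matrix B B ℂ :=
  U * blockDiagonal' (fun j => L j ⊗ₖ R j) * Uᴴ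

variable {U : Matrix B (Σ j : Fin m, Fin (dL j) × Fin (dR j)) ℂ}

omit [DecidableEq B] in
theorem blockForm_mul (hU : Uᴴ * U = 1) (L L' : ∀ j, Matrix (Fin (dL j)) (Fin (dL j)) ℂ)
    (R R' : ∀ j, Matrix (Fin (dR j)) (Fin (dR j)) ℂ) :
    blockForm U L R * blockForm U L' R' =
      blockForm U (fun j => L j * L' j) (fun j => R j * R' j) := by
  calc _ = U * blockDiagonal' (fun j => L j ⊗ₖ R j) * (Uᴴ * U) *
        blockDiagonal' (fun j => L' j ⊗ₖ R' j) * Uᴴ := by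
        simp only [blockForm, Matrix.mul_assoc]
    _ = _ := by
        rw [hU, Matrix.mul_one, Matrix.mul_assoc U, ← Matrix.blockDiagonal'_mul, blockForm]
        simp only [Matrix.mul_kronecker_mul]

omit [Fintype B] in
theorem eq_mul_mul_of_conj_eq [Fintype B] {ι : Type*} [Fintype ι] {U : Matrix B ι ℂ}
    (hU : U * Uᴴ = 1) {x : Matrix B B ℂ} {D : Matrix ι ι ℂ} (h : Uᴴ * x * U = D) :
    x = U * D * Uᴴ := by
  rw [← h]
  calc x = (U * Uᴴ) * x * (U * Uᴴ) := by rw [hU, Matrix.one_mul, Matrix.mul_one]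
    _ = _ := by simp only [Matrix.mul_assoc]

/-- The structure theorem for the commutant of a set of matrices. -/
theorem exists_commutant_structure (S : Set (Matrix B B ℂ)) :
    ∃ (m : ℕ) (dL dR : Fin m → ℕ) (U : Matrix B (Σ j : Fin m, Fin (dL j) × Fin (dR j)) ℂ),
      (∀ j, 0 < dL j) ∧ (∀ j, 0 < dR j) ∧ Uᴴ * U = 1 ∧ U * Uᴴ = 1 ∧
      (∀ x ∈ StarSubalgebra.centralizer ℂ S, ∃ R, x = blockForm U (fun _ => 1) R) ∧
      (∀ s, (∀ x ∈ StarSubalgebra.centralizer ℂ S, s * x = x * s) →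
        ∃ L, s = blockForm U L (fun _ => 1)) ∧
      (∀ R, blockForm U (fun _ => 1) R ∈ StarSubalgebra.centralizer ℂ S) := by
  obtain ⟨m, dR, e, v, hdR, he, hvN, hve, hvv, hsum, hort⟩ := exists_matrixUnits S
  choose dL F hdL hF hF' using fun j =>
    exists_isometry_of_projection (he j).herm (he j).idem (he j).ne_zero
  let U : Matrix B (Σ j : Fin m, Fin (dL j) × Fin (dR j)) ℂ :=
    Matrix.of fun b p => (v p.1 p.2.2 * F p.1) b p.2.1
  have hent : ∀ (x : Matrix B B ℂ) (j k : Fin m) (l : Fin (dL j)) (r : Fin (dR j))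
      (l' : Fin (dL k)) (r' : Fin (dR k)), (Uᴴ * x * U) ⟨j, (l, r)⟩ ⟨k, (l', r')⟩ =
        ((F j)ᴴ * ((v j r)ᴴ * x * v k r') * F k) l l' := by
    intro x j k l r l' r'
    have h1 : (Uᴴ * x * U) ⟨j, (l, r)⟩ ⟨k, (l', r')⟩ =
        ((v j r * F j)ᴴ * x * (v k r' * F k)) l l' := rfl
    rw [h1, Matrix.conjTranspose_mul]
    simp only [Matrix.mul_assoc]
  have hFe : ∀ j, (F j)ᴴ * e j = (F j)ᴴ := fun j => by
    rw [← hF', ← Matrix.mul_assoc, hF, Matrix.one_mul]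
  have hev : ∀ j r, e j * (v j r)ᴴ = (v j r)ᴴ := fun j r => by
    conv_rhs => rw [← hve, Matrix.conjTranspose_mul, (he j).herm]
  have hcut : ∀ (x : Matrix B B ℂ) j k r r',
      (v j r)ᴴ * x * v k r' = e j * ((v j r)ᴴ * x * v k r') * e k := by
    intro x j k r r'
    rw [← Matrix.mul_assoc, ← Matrix.mul_assoc, hev, Matrix.mul_assoc _ (v k r'), hve]
  have hmem : ∀ x ∈ StarSubalgebra.centralizer ℂ S, ∀ j k r r',
      (v j r)ᴴ * x * v k r' ∈ StarSubalgebra.centralizer ℂ S := fun x hx j k r r' =>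
    mul_mem (mul_mem (star_mem (hvN j r)) hx) (hvN k r')
  have hne : ∀ x ∈ StarSubalgebra.centralizer ℂ S, ∀ j k, j ≠ k → ∀ r r',
      (v j r)ᴴ * x * v k r' = 0 := fun x hx j k hjk r r' => by
    rw [hcut, hort j k hjk _ (hmem x hx j k r r')]
  have hUU : U * Uᴴ = 1 := by
    rw [← hsum]
    ext b b'
    rw [Matrix.mul_apply, Fintype.sum_sigma, Matrix.sum_apply]
    refine Finset.sum_congr rfl fun j _ => ?_
    rw [Fintype.sum_prod_type, Finset.sum_comm, Matrix.sum_apply]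
    refine Finset.sum_congr rfl fun r _ => ?_
    have h1 : v j r * (v j r)ᴴ = (v j r * F j) * (v j r * F j)ᴴ := by
      rw [Matrix.conjTranspose_mul, Matrix.mul_assoc, ← Matrix.mul_assoc (F j), hF', hev]
    rw [h1]
    rfl
  have hright : ∀ x ∈ StarSubalgebra.centralizer ℂ S, ∃ R, x = blockForm U (fun _ => 1) R := by
    intro x hx
    choose z hz using fun j r r' => (he j).minimal _ (hmem x hx j j r r')
    refine ⟨fun j => Matrix.of (z j), eq_mul_mul_of_conj_eq hUU ?_⟩
    ext ⟨j, l, r⟩ ⟨k, l', r'⟩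
    rw [hent]
    by_cases hjk : j = k
    · subst hjk
      rw [hcut, hz, Matrix.blockDiagonal'_apply_eq, Matrix.kroneckerMap_apply, Matrix.mul_smul,
        hFe, Matrix.smul_mul, hF, Matrix.smul_apply]
      exact mul_comm _ _
    · rw [hne x hx j k hjk, Matrix.blockDiagonal'_apply_ne _ _ _ hjk, Matrix.mul_zero,
        Matrix.zero_mul, Matrix.zero_apply]
  have hleft : ∀ s, (∀ x ∈ StarSubalgebra.centralizer ℂ S, s * x = x * s) →
      Uᴴ * s * U = blockDiagonal' (fun j => ((F j)ᴴ * s * F j) ⊗ₖ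
        (1 : Matrix (Fin (dR j)) (Fin (dR j)) ℂ)) := by
    intro s hs
    ext ⟨j, l, r⟩ ⟨k, l', r'⟩
    rw [hent, Matrix.mul_assoc (v j r)ᴴ, hs _ (hvN k r'), ← Matrix.mul_assoc (v j r)ᴴ]
    by_cases hjk : j = k
    · subst hjk
      rw [hvv, Matrix.blockDiagonal'_apply_eq, Matrix.kroneckerMap_apply, Matrix.one_apply]
      split_ifs with h
      · rw [← Matrix.mul_assoc, hFe, mul_one]
      · simp
    · have h1 := hne 1 (one_mem _) j k hjk r r'
      rw [Matrix.mul_one] at h1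
      rw [h1, Matrix.blockDiagonal'_apply_ne _ _ _ hjk]
      simp
  have hU : Uᴴ * U = 1 := by
    have h1 := hleft 1 fun x _ => by rw [Matrix.one_mul, Matrix.mul_one]
    simp only [Matrix.mul_one, hF, Matrix.one_kronecker_one] at h1
    rw [h1]
    exact Matrix.blockDiagonal'_one
  have hleft' : ∀ s, (∀ x ∈ StarSubalgebra.centralizer ℂ S, s * x = x * s) →
      ∃ L, s = blockForm U L (fun _ => 1) := fun s hs =>
    ⟨_, eq_mul_mul_of_conj_eq hUU (hleft s hs)⟩
  refine ⟨m, dL, dR, U, hdL, hdR, hU, hUU, hright, hleft', fun R => ?_⟩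
  have hcomm : ∀ s, (∀ x ∈ StarSubalgebra.centralizer ℂ S, s * x = x * s) →
      s * blockForm U (fun _ => 1) R = blockForm U (fun _ => 1) R * s := by
    intro s hs
    obtain ⟨L, rfl⟩ := hleft' s hs
    rw [blockForm_mul hU, blockForm_mul hU]
    simp only [Matrix.one_mul, Matrix.mul_one]
  rw [StarSubalgebra.mem_centralizer_iff]
  exact fun s hs => ⟨hcomm s fun x hx => (StarSubalgebra.mem_centralizer_iff ℂ |>.1 hx s hs).1,
    hcomm (star s) fun x hx => (StarSubalgebra.mem_centralizer_iff ℂ |>.1 hx s hs).2⟩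

end BlockForm

section NormalizerForm

variable {B : Type*} [Fintype B] [DecidableEq B]

omit [DecidableEq B] in
theorem Matrix.PosDef.conj_isometry {n : Type*} [Fintype n] [DecidableEq n] {β : Matrix B B ℂ}
    (hβ : β.PosDef) {U : Matrix B n ℂ} (hU : Uᴴ * U = 1) : (Uᴴ * β * U).PosDef := by
  refine hβ.conjTranspose_mul_mul_same fun x y h => ?_
  have h1 := congrArg (Uᴴ *ᵥ ·) h
  simpa only [Matrix.mulVec_mulVec, hU, Matrix.one_mulVec] using h1

/-- A matrix commuting with all matrices is a scalar. -/
theorem Matrix.exists_eq_smul_one_of_forall_commute {n : Type*} [Fintype n] [DecidableEq n]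
    {M : Matrix n n ℂ} (h : ∀ R : Matrix n n ℂ, R * M = M * R) : ∃ z : ℂ, M = z • 1 := by
  obtain ⟨z, hz⟩ := Matrix.mem_range_scalar_of_commute_single (M := M) fun i j _ => h _
  exact ⟨z, by rw [← hz, Matrix.scalar_apply, Matrix.smul_one_eq_diagonal]⟩

variable {m : ℕ} {dL dR : Fin m → ℕ}

theorem mul_blockDiagonal'_one_kronecker_apply {ι : Type*}
    (G : Matrix ι (Σ j : Fin m, Fin (dL j) × Fin (dR j)) ℂ)
    (R : ∀ j, Matrix (Fin (dR j)) (Fin (dR j)) ℂ) (p : ι) (k : Fin m) (l : Fin (dL k))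
    (r : Fin (dR k)) :
    (G * blockDiagonal' fun j => (1 : Matrix (Fin (dL j)) (Fin (dL j)) ℂ) ⊗ₖ R j) p ⟨k, (l, r)⟩ =
      ∑ r', G p ⟨k, (l, r')⟩ * R k r' r := by
  rw [Matrix.mul_apply, Fintype.sum_sigma, Finset.sum_eq_single k, Fintype.sum_prod_type,
    Finset.sum_eq_single l]
  · simp [Matrix.blockDiagonal'_apply_eq]
  · intro l' _ h
    simp [Matrix.blockDiagonal'_apply_eq, h]
  · simp
  · intro j _ h
    simp [Matrix.blockDiagonal'_apply_ne _ _ _ h]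
  · simp

theorem blockDiagonal'_one_kronecker_mul_apply {ι : Type*}
    (G : Matrix (Σ j : Fin m, Fin (dL j) × Fin (dR j)) ι ℂ)
    (R : ∀ j, Matrix (Fin (dR j)) (Fin (dR j)) ℂ) (p : ι) (k : Fin m) (l : Fin (dL k))
    (r : Fin (dR k)) :
    ((blockDiagonal' fun j => (1 : Matrix (Fin (dL j)) (Fin (dL j)) ℂ) ⊗ₖ R j) * G) ⟨k, (l, r)⟩ p =
      ∑ r', R k r r' * G ⟨k, (l, r')⟩ p := by
  rw [Matrix.mul_apply, Fintype.sum_sigma, Finset.sum_eq_single k, Fintype.sum_prod_type,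
    Finset.sum_eq_single l]
  · simp [Matrix.blockDiagonal'_apply_eq]
  · intro l' _ h
    simp [Matrix.blockDiagonal'_apply_eq, h.symm]
  · simp
  · intro j _ h
    simp [Matrix.blockDiagonal'_apply_ne _ _ _ h.symm]
  · simp

/-- A positive definite matrix which normalizes the algebra `⊕ⱼ 1 ⊗ Mⱼ` is a direct sum of product
operators. -/
theorem exists_blockForm_of_normalizes {U : Matrix B (Σ j : Fin m, Fin (dL j) × Fin (dR j)) ℂ}
    (hdL : ∀ j, 0 < dL j) (hU : Uᴴ * U = 1) (hU' : U * Uᴴ = 1) {β : Matrix B B ℂ}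
    (hβ : β.PosDef)
    (hnorm : ∀ R, ∃ R', β * blockForm U (fun _ => 1) R = blockForm U (fun _ => 1) R' * β) :
    ∃ βL βR, β = blockForm U βL βR := by
  set G := Uᴴ * β * U with hGdef
  have hG : G.PosDef := hβ.conj_isometry hU
  let blk : ∀ j k, Fin (dL j) → Fin (dL k) → Matrix (Fin (dR j)) (Fin (dR k)) ℂ :=
    fun j k l l' => Matrix.of fun r r' => G ⟨j, (l, r)⟩ ⟨k, (l', r')⟩
  have hunit : ∀ j l, IsUnit (blk j j l l).det := fun j l => by
    have h1 : (blk j j l l).PosDef := hG.submatrix (e := fun r => ⟨j, (l, r)⟩) fun r r' h => by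
      simpa using h
    exact (Matrix.isUnit_iff_isUnit_det _).1 h1.isUnit
  have hrel : ∀ R : ∀ j, Matrix (Fin (dR j)) (Fin (dR j)) ℂ,
      ∃ R' : ∀ j, Matrix (Fin (dR j)) (Fin (dR j)) ℂ,
      ∀ j k l l', blk j k l l' * R k = R' j * blk j k l l' := by
    intro R
    obtain ⟨R', hR'⟩ := hnorm R
    refine ⟨R', fun j k l l' => ?_⟩
    have h1 : G * (blockDiagonal' fun j => (1 : Matrix (Fin (dL j)) (Fin (dL j)) ℂ) ⊗ₖ R j) =
        (blockDiagonal' fun j => (1 : Matrix (Fin (dL j)) (Fin (dL j)) ℂ) ⊗ₖ R' j) * G := by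
      have h2 := congrArg (fun M => Uᴴ * M * U) hR'
      simp only [blockForm] at h2
      calc _ = Uᴴ * (β * (U * (blockDiagonal' fun j =>
              (1 : Matrix (Fin (dL j)) (Fin (dL j)) ℂ) ⊗ₖ R j) * Uᴴ)) * U := by
            simp only [hGdef, Matrix.mul_assoc, hU, Matrix.mul_one]
        _ = _ := h2
        _ = (Uᴴ * U) * (blockDiagonal' fun j =>
              (1 : Matrix (Fin (dL j)) (Fin (dL j)) ℂ) ⊗ₖ R' j) * G := by
            simp only [hGdef, Matrix.mul_assoc]
        _ = _ := by rw [hU, Matrix.one_mul]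
    ext r r'
    have h2 := congrFun (congrFun h1 ⟨j, (l, r)⟩) ⟨k, (l', r')⟩
    rwa [mul_blockDiagonal'_one_kronecker_apply, blockDiagonal'_one_kronecker_mul_apply] at h2
  have hoff : ∀ j k, j ≠ k → ∀ l l', blk j k l l' = 0 := by
    intro j k hjk l l'
    obtain ⟨R', hR'⟩ := hrel (Pi.single k 1)
    have h1 := hR' j j l l
    rw [Pi.single_eq_of_ne hjk, Matrix.mul_zero] at h1
    have h2 : R' j = 0 := by
      have h3 := congrArg (· * (blk j j l l)⁻¹) h1
      simpa [Matrix.mul_assoc, Matrix.mul_nonsing_inv _ (hunit j l)] using h3.symm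
    have h4 := hR' j k l l'
    rwa [Pi.single_eq_same, Matrix.mul_one, h2, Matrix.zero_mul] at h4
  let l₀ : ∀ j, Fin (dL j) := fun j => ⟨0, hdL j⟩
  have hdiag : ∀ j l l', ∃ z : ℂ, blk j j l l' = z • blk j j (l₀ j) (l₀ j) := by
    intro j l l'
    set b := blk j j (l₀ j) (l₀ j) with hb
    have hbu : IsUnit b.det := hunit j (l₀ j)
    obtain ⟨z, hz⟩ := Matrix.exists_eq_smul_one_of_forall_commute (M := b⁻¹ * blk j j l l')
      fun M => by
        obtain ⟨R', hR'⟩ := hrel (Pi.single j M)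
        have h1 := hR' j j (l₀ j) (l₀ j)
        have h2 := hR' j j l l'
        rw [Pi.single_eq_same] at h1 h2
        rw [← hb] at h1
        calc M * (b⁻¹ * blk j j l l') = (b⁻¹ * b) * M * b⁻¹ * blk j j l l' := by
              rw [Matrix.nonsing_inv_mul _ hbu]; simp only [Matrix.one_mul, Matrix.mul_assoc]
          _ = b⁻¹ * (b * M) * b⁻¹ * blk j j l l' := by simp only [Matrix.mul_assoc]
          _ = b⁻¹ * R' j * (b * b⁻¹) * blk j j l l' := by
              rw [h1]; simp only [Matrix.mul_assoc]
          _ = b⁻¹ * (blk j j l l' * M) := by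
              rw [Matrix.mul_nonsing_inv _ hbu, h2]; simp only [Matrix.mul_one, Matrix.mul_assoc]
          _ = _ := by rw [Matrix.mul_assoc]
    refine ⟨z, ?_⟩
    calc blk j j l l' = b * (b⁻¹ * blk j j l l') := by
          rw [← Matrix.mul_assoc, Matrix.mul_nonsing_inv _ hbu, Matrix.one_mul]
      _ = _ := by rw [hz, Matrix.mul_smul, Matrix.mul_one]
  choose z hz using hdiag
  refine ⟨fun j => Matrix.of (z j), fun j => blk j j (l₀ j) (l₀ j),
    eq_mul_mul_of_conj_eq hU' ?_⟩
  rw [← hGdef]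
  ext ⟨j, l, r⟩ ⟨k, l', r'⟩
  by_cases hjk : j = k
  · subst hjk
    rw [Matrix.blockDiagonal'_apply_eq]
    exact congrFun (congrFun (hz j l l') r) r'
  · rw [Matrix.blockDiagonal'_apply_ne _ _ _ hjk]
    exact congrFun (congrFun (hoff j k hjk l l') r) r'

end NormalizerForm

section Resolvent

variable {V : Type*} [AddCommGroup V] [Module ℂ V] [FiniteDimensional ℂ V]

/-- The span of the resolvent family of an operator at a vector contains the vector and is
invariant. -/
theorem span_resolvent_invariant {Δ : V →ₗ[ℂ] V} {v : V} {y : Set.Ioi (0 : ℝ) → V}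
    (hy : ∀ t : Set.Ioi (0 : ℝ), Δ (y t) + (t.1 : ℂ) • y t = v) :
    v ∈ Submodule.span ℂ (Set.range y) ∧
      ∀ x ∈ Submodule.span ℂ (Set.range y), Δ x ∈ Submodule.span ℂ (Set.range y) := by
  set Y := Submodule.span ℂ (Set.range y) with hY
  have hmem : ∀ t, y t ∈ Y := fun t => Submodule.subset_span ⟨t, rfl⟩
  obtain ⟨s, hs⟩ : ∃ s, y s ∈ Submodule.span ℂ (y '' (Set.univ \ {s})) := by
    by_contra! hcon
    have h1 : LinearIndependent ℂ y := linearIndependent_iff_notMem_span.2 hcon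
    have h2 : Finite (Set.Ioi (0 : ℝ)) := h1.finite
    exact (Set.Ioi_infinite (0 : ℝ)) (Set.toFinite _)
  let Δs : V →ₗ[ℂ] V := Δ + (s.1 : ℂ) • LinearMap.id
  have hΔs : ∀ x, Δs x = Δ x + (s.1 : ℂ) • x := fun x => rfl
  have hsub : Submodule.span ℂ (y '' (Set.univ \ {s})) ≤ Y.map Δs := by
    rw [Submodule.span_le]
    rintro _ ⟨t, ht, rfl⟩
    have hts : (t.1 : ℂ) - s.1 ≠ 0 := fun h =>
      ht.2 (Subtype.ext (by exact_mod_cast sub_eq_zero.1 h))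
    refine ⟨((t.1 : ℂ) - s.1)⁻¹ • (y s - y t),
      Submodule.smul_mem _ _ (Submodule.sub_mem _ (hmem s) (hmem t)), ?_⟩
    have h1 : Δs (y s - y t) = ((t.1 : ℂ) - s.1) • y t := by
      rw [map_sub, hΔs, hy s, hΔs, ← hy t, sub_smul]
      abel
    rw [map_smul, h1, smul_smul, inv_mul_cancel₀ hts, one_smul]
  have hle : Y ≤ Y.map Δs := by
    refine Submodule.span_le.2 ?_
    rintro _ ⟨t, rfl⟩
    by_cases h : t = s
    · exact hsub (h ▸ hs)
    · exact hsub (Submodule.subset_span ⟨t, ⟨trivial, h⟩, rfl⟩)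
  have heq : Y = Y.map Δs :=
    Submodule.eq_of_le_of_finrank_le hle (Submodule.finrank_map_le _ _)
  have hinv : ∀ x ∈ Y, Δ x ∈ Y := fun x hx => by
    have h1 : Δs x ∈ Y := by rw [heq]; exact ⟨x, hx, rfl⟩
    have h2 : Δ x = Δs x - (s.1 : ℂ) • x := by rw [hΔs, add_sub_cancel_right]
    rw [h2]
    exact Submodule.sub_mem _ h1 (Submodule.smul_mem _ _ hx)
  refine ⟨?_, hinv⟩
  rw [← hy s]
  exact Submodule.add_mem _ (hinv _ (hmem s)) (Submodule.smul_mem _ _ (hmem s))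

theorem mem_of_map_mem_of_injective {Δ : V →ₗ[ℂ] V} (hΔ : Function.Injective Δ)
    {Y : Submodule ℂ V} (hY : ∀ x ∈ Y, Δ x ∈ Y) {x : V} (hx : Δ x ∈ Y) : x ∈ Y := by
  have h1 : Y.map Δ = Y := by
    refine Submodule.eq_of_le_of_finrank_le (Submodule.map_le_iff_le_comap.2 hY) ?_
    rw [(Submodule.equivMapOfInjective Δ hΔ Y).finrank_eq]
  rw [← h1] at hx
  obtain ⟨y, hy, hyx⟩ := hx
  exact hΔ hyx ▸ hy

end Resolvent

section ModularSubmodule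

variable {A B C : Type*} [Fintype A] [DecidableEq A] [Fintype B] [DecidableEq B] [Fintype C]
  [DecidableEq C]

/-- The subspace of operators on `A ⊗ B` generated by the resolvents of the relative modular
operator of a state with vanishing conditional mutual information. -/
theorem exists_modular_submodule {W : Matrix (A × B × C) (A × B × C) ℂ}
    (hK : ∀ t : ℝ, 0 < t → ∃ Y : Matrix (A × B) (A × B) ℂ,
      liftBC (margBC W) * liftAB Y + (t : ℂ) • (liftAB Y * W) = W)
    {G' : Matrix (A × B) (A × B) ℂ} {β' P : Matrix B B ℂ}
    (hG : margAB W * G' = 1) (hβ : β' * margB W = 1)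
    (hPG : leftOne P * margAB W = margAB W * leftOne P) (hPβ : P * margB W = margB W * P) :
    ∃ Y : Submodule ℂ (Matrix (A × B) (A × B) ℂ), 1 ∈ Y ∧
      (∀ x ∈ Y, leftOne P * x = x * leftOne P) ∧
      (∀ x ∈ Y, leftOne (margB W) * x * G' ∈ Y) ∧
      (∀ x ∈ Y, leftOne β' * x * margAB W ∈ Y) ∧
      (∀ x ∈ Y, liftBC (margBC W) * liftAB x =
        liftAB (leftOne (margB W) * x * G') * W) := by
  set G := margAB W with hGdef
  set β := margB W with hβdef
  have hG2 : G' * G = 1 := mul_eq_one_comm.1 hG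
  let b : Matrix (A × B) (A × B) ℂ := leftOne β
  let b' : Matrix (A × B) (A × B) ℂ := leftOne β'
  let p : Matrix (A × B) (A × B) ℂ := leftOne P
  have hb : b' * b = 1 := by rw [← map_mul, hβ, map_one]
  have hpb : p * b = b * p := by rw [← map_mul, hPβ, map_mul]
  have hpG' : p * G' = G' * p := by
    calc p * G' = G' * (G * p) * G' := by rw [← Matrix.mul_assoc, hG2, Matrix.one_mul]
      _ = G' * p * (G * G') := by rw [← hPG]; simp only [Matrix.mul_assoc]; rfl
      _ = G' * p := by rw [hG, Matrix.mul_one]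
  let Δ : Matrix (A × B) (A × B) ℂ →ₗ[ℂ] Matrix (A × B) (A × B) ℂ :=
    LinearMap.mulRight ℂ G' ∘ₗ LinearMap.mulLeft ℂ b
  have hΔ : ∀ x, Δ x = b * x * G' := fun x => rfl
  have hΔinv : ∀ x, b' * Δ x * G = x := fun x => by
    calc b' * (b * x * G') * G = (b' * b) * x * (G' * G) := by simp only [Matrix.mul_assoc]
      _ = x := by rw [hb, hG2, Matrix.one_mul, Matrix.mul_one]
  have hinj : Function.Injective Δ := fun x y hxy => by rw [← hΔinv x, hxy, hΔinv]
  choose y hy using fun t : Set.Ioi (0 : ℝ) => hK t.1 t.2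
  have hy1 : ∀ t, Δ (y t) + (t.1 : ℂ) • y t = 1 := by
    intro t
    have h1 : b * y t + (t.1 : ℂ) • (y t * G) = G := by
      have h2 := congrArg margAB (hy t)
      have h3 : margAB (liftBC (margBC W) * liftAB (y t) + (t.1 : ℂ) • (liftAB (y t) * W)) =
          margAB (liftBC (margBC W) * liftAB (y t)) + (t.1 : ℂ) • margAB (liftAB (y t) * W) := by
        ext i j
        simp [margAB, Finset.sum_add_distrib, Finset.mul_sum]
      rw [h3, margAB_mul_liftAB, margAB_liftAB_mul, margAB_liftBC, ← margB_eq_ptr_margBC] at h2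
      exact h2
    calc Δ (y t) + (t.1 : ℂ) • y t = (b * y t + (t.1 : ℂ) • (y t * G)) * G' := by
          rw [Matrix.add_mul, Matrix.smul_mul, Matrix.mul_assoc (y t), hG, Matrix.mul_one, hΔ]
      _ = 1 := by rw [h1, hG]
  obtain ⟨h1mem, hinv⟩ := span_resolvent_invariant hy1
  have hrel : ∀ x ∈ Submodule.span ℂ (Set.range y),
      liftBC (margBC W) * liftAB x = liftAB (Δ x) * W := by
    intro x hx
    induction hx using Submodule.span_induction with
    | mem x hx =>
      obtain ⟨t, rfl⟩ := hx
      have h1 : Δ (y t) = 1 - (t.1 : ℂ) • y t := eq_sub_of_add_eq (hy1 t)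
      rw [h1, map_sub, map_one, map_smul, Matrix.sub_mul, Matrix.one_mul, Matrix.smul_mul]
      exact eq_sub_of_add_eq (hy t)
    | zero => simp
    | add x x' _ _ h h' => rw [map_add, map_add, map_add, Matrix.mul_add, h, h', Matrix.add_mul]
    | smul z x _ h => rw [map_smul, map_smul, map_smul, Matrix.mul_smul, h, Matrix.smul_mul]
  let Z : Submodule ℂ (Matrix (A × B) (A × B) ℂ) :=
    LinearMap.ker (LinearMap.mulLeft ℂ p - LinearMap.mulRight ℂ p)
  have hZ : ∀ x, x ∈ Z ↔ p * x = x * p := fun x => by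
    rw [LinearMap.mem_ker, LinearMap.sub_apply, sub_eq_zero]; rfl
  have hΔmem : ∀ x ∈ Submodule.span ℂ (Set.range y) ⊓ Z,
      Δ x ∈ Submodule.span ℂ (Set.range y) ⊓ Z := by
    rintro x ⟨hx1, hx2⟩
    refine ⟨hinv x hx1, (hZ _).2 ?_⟩
    have hx3 := (hZ x).1 hx2
    calc p * (b * x * G') = (p * b) * x * G' := by simp only [Matrix.mul_assoc]
      _ = b * (p * x) * G' := by rw [hpb]; simp only [Matrix.mul_assoc]
      _ = b * x * (p * G') := by rw [hx3]; simp only [Matrix.mul_assoc]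
      _ = _ := by rw [hpG']; simp only [hΔ, Matrix.mul_assoc]
  refine ⟨Submodule.span ℂ (Set.range y) ⊓ Z, ⟨h1mem, (hZ 1).2 ?_⟩, fun x hx => (hZ x).1 hx.2,
    hΔmem, fun x hx => ?_, fun x hx => hrel x hx.1⟩
  · rw [Matrix.mul_one, Matrix.one_mul]
  · refine mem_of_map_mem_of_injective hinj hΔmem ?_
    have hb2 : b * b' = 1 := mul_eq_one_comm.1 hb
    have h1 : Δ (b' * x * G) = x := by
      calc b * (b' * x * G) * G' = (b * b') * x * (G * G') := by simp only [Matrix.mul_assoc]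
        _ = x := by rw [hb2, hG, Matrix.one_mul, Matrix.mul_one]
    exact h1.symm ▸ hx

end ModularSubmodule

section Factorization

variable {A B C : Type*} [Fintype A] [DecidableEq A] [Fintype B] [DecidableEq B] [Fintype C]
  [DecidableEq C]

theorem sliceA_leftOne_mul (z : Matrix B B ℂ) (x : Matrix (A × B) (A × B) ℂ) (a a' : A) :
    sliceA (leftOne z * x) a a' = z * sliceA x a a' := by
  ext b b'
  simp only [Matrix.submatrix_apply, Matrix.mul_apply, leftOne_apply, Fintype.sum_prod_type,
    Matrix.one_apply, mul_ite, mul_one, mul_zero, ite_mul, zero_mul]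
  rw [Finset.sum_comm]
  simp

theorem sliceA_mul_leftOne (z : Matrix B B ℂ) (x : Matrix (A × B) (A × B) ℂ) (a a' : A) :
    sliceA (x * leftOne z) a a' = sliceA x a a' * z := by
  ext b b'
  simp only [Matrix.submatrix_apply, Matrix.mul_apply, leftOne_apply, Fintype.sum_prod_type,
    Matrix.one_apply, mul_ite, mul_one, mul_zero]
  rw [Finset.sum_comm]
  simp

theorem leftOne_commute_iff (z : Matrix B B ℂ) (x : Matrix (A × B) (A × B) ℂ) :
    leftOne z * x = x * leftOne z ↔ ∀ a a', z * sliceA x a a' = sliceA x a a' * z := by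
  constructor
  · intro h a a'
    rw [← sliceA_leftOne_mul, h, sliceA_mul_leftOne]
  · intro h
    ext ⟨a, b⟩ ⟨a', b'⟩
    have h1 := h a a'
    rw [← sliceA_leftOne_mul, ← sliceA_mul_leftOne] at h1
    exact congrFun (congrFun h1 b) b'

theorem slice_mul_lift (W : Matrix (A × B × C) (A × B × C) ℂ) (P : Matrix B B ℂ) (a a' : A)
    (c c' : C) :
    slice (W * liftAB (leftOne P)) a a' c c' = slice W a a' c c' * P := by
  rw [slice_mul_liftAB, Finset.sum_eq_single a']
  · congr 1
    ext b b'
    simp [leftOne_apply]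
  · intro a'' _ h
    have : sliceA (leftOne P) a'' a' = 0 := by
      ext b b'
      simp [leftOne_apply, h]
    rw [this, Matrix.mul_zero]
  · simp

/-- The core factorization: a state whose marginals are invertible and whose conditional mutual
information vanishes is a direct sum of products over `B`. -/
theorem exists_blockForm_slice_mul {W : Matrix (A × B × C) (A × B × C) ℂ} (hW : W.IsHermitian)
    (hK : ∀ t : ℝ, 0 < t → ∃ Y : Matrix (A × B) (A × B) ℂ,
      liftBC (margBC W) * liftAB Y + (t : ℂ) • (liftAB Y * W) = W)
    (hG : IsUnit (margAB W).det) (hβ : (margB W).PosDef) {P : Matrix B B ℂ} (hP : Pᴴ = P)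
    (hPG : leftOne P * margAB W = margAB W * leftOne P) (hPβ : P * margB W = margB W * P) :
    ∃ (m : ℕ) (dL dR : Fin m → ℕ) (U : Matrix B (Σ j : Fin m, Fin (dL j) × Fin (dR j)) ℂ),
      (∀ j, 0 < dL j) ∧ (∀ j, 0 < dR j) ∧ Uᴴ * U = 1 ∧ U * Uᴴ = 1 ∧
      ∃ (L : A → A → ∀ j, Matrix (Fin (dL j)) (Fin (dL j)) ℂ)
        (R : C → C → ∀ j, Matrix (Fin (dR j)) (Fin (dR j)) ℂ),
        ∀ a a' c c', slice W a a' c c' * P = blockForm U (L a a') (R c c') := by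
  obtain ⟨Y, hY1, hYP, hYΔ, hYΔ', hYrel⟩ := exists_modular_submodule hK
    (Matrix.mul_nonsing_inv _ hG)
    (Matrix.nonsing_inv_mul _ ((Matrix.isUnit_iff_isUnit_det _).1 hβ.isUnit)) hPG hPβ
  set G := margAB W with hGdef
  set β := margB W with hβdef
  set G' := G⁻¹
  set β' := β⁻¹
  have hGG : G * G' = 1 := Matrix.mul_nonsing_inv _ hG
  have hGG' : G' * G = 1 := Matrix.nonsing_inv_mul _ hG
  have hβu : IsUnit β.det := (Matrix.isUnit_iff_isUnit_det _).1 hβ.isUnit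
  have hGh : Gᴴ = G := by
    ext p q
    simp only [hGdef, margAB, Matrix.conjTranspose_apply, Matrix.of_apply, star_sum]
    exact Finset.sum_congr rfl fun c _ => hW.apply _ _
  have hG'h : G'ᴴ = G' := by rw [Matrix.conjTranspose_nonsing_inv, hGh]
  have hRh : (margBC W)ᴴ = margBC W := by
    ext p q
    simp only [margBC, Matrix.conjTranspose_apply, Matrix.of_apply, star_sum]
    exact Finset.sum_congr rfl fun a _ => hW.apply _ _
  have hβh : βᴴ = β := hβ.1
  have hβ'h : β'ᴴ = β' := by rw [Matrix.conjTranspose_nonsing_inv, hβh]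
  let b : Matrix (A × B) (A × B) ℂ := leftOne β
  let b' : Matrix (A × B) (A × B) ℂ := leftOne β'
  have hbb' : b * b' = 1 := by rw [← map_mul, Matrix.mul_nonsing_inv _ hβu, map_one]
  have hb'b : b' * b = 1 := by rw [← map_mul, Matrix.nonsing_inv_mul _ hβu, map_one]
  have hbh : bᴴ = b := by rw [ampl_conjTranspose, hβh]
  have hb'h : b'ᴴ = b' := by rw [ampl_conjTranspose, hβ'h]
  let T : Matrix (B × C) (B × C) ℂ := rightOne β' * margBC W
  have hT : liftBC (A := A) T = liftAB b' * liftBC (margBC W) := by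
    rw [map_mul, ← liftAB_leftOne]
  have hRT : liftBC (margBC W) = liftAB b * liftBC T := by
    rw [hT, ← Matrix.mul_assoc, ← map_mul, hbb', map_one, Matrix.one_mul]
  have hWT : W = liftAB G * liftBC T := by
    have h1 := hYrel 1 hY1
    rw [map_one, Matrix.mul_one, Matrix.mul_one] at h1
    rw [hT, h1, ← Matrix.mul_assoc, ← Matrix.mul_assoc, ← map_mul, ← map_mul]
    have h2 : G * b' * (leftOne β * G') = 1 := by
      calc G * b' * (b * G') = G * (b' * b) * G' := by simp only [Matrix.mul_assoc]
        _ = 1 := by rw [hb'b, Matrix.mul_one, hGG]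
    rw [h2, map_one, Matrix.one_mul]
  have hcomm : ∀ x ∈ Y, liftBC T * liftAB x = liftAB x * liftBC T := by
    intro x hx
    have h1 : liftBC (margBC W) * liftAB x = liftAB (b * x) * liftBC T := by
      rw [hYrel x hx]
      refine (congrArg (liftAB (leftOne β * x * G') * ·) hWT).trans ?_
      rw [← Matrix.mul_assoc, ← map_mul, Matrix.mul_assoc (leftOne β * x), hGG', Matrix.mul_one]
    rw [hT, Matrix.mul_assoc, h1, ← Matrix.mul_assoc, ← map_mul, ← Matrix.mul_assoc b', hb'b,
      Matrix.one_mul, hT]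
  have hcommΔ : ∀ x ∈ Y, liftBC T * liftAB (b * x * G')ᴴ = liftAB (b * x * G')ᴴ * liftBC T := by
    intro x hx
    have h1 : liftAB (b' * xᴴ * b) * liftBC T = liftBC T * liftAB (b' * xᴴ * b) := by
      have h2 := congrArg Matrix.conjTranspose (hcomm x hx)
      rw [Matrix.conjTranspose_mul, Matrix.conjTranspose_mul, ampl_conjTranspose, hT,
        Matrix.conjTranspose_mul, ampl_conjTranspose, ampl_conjTranspose, hRh, hb'h, hRT] at h2
      have h3 : liftAB b' * (liftAB xᴴ * (liftAB b * liftBC T * liftAB b')) * liftAB (C := C) b =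
          liftAB b' * ((liftAB b * liftBC T * liftAB b') * liftAB xᴴ) * liftAB b := by rw [h2]
      have h4 : liftAB (C := C) b' * liftAB b = 1 := by rw [← map_mul, hb'b, map_one]
      calc liftAB (b' * xᴴ * b) * liftBC T
          = liftAB b' * (liftAB xᴴ * (liftAB b * liftBC T * (liftAB b' * liftAB b))) := by
            rw [h4, Matrix.mul_one]; simp only [map_mul, Matrix.mul_assoc]
        _ = _ := by simpa only [Matrix.mul_assoc] using h3
        _ = (liftAB b' * liftAB b) * liftBC T * (liftAB b' * (liftAB xᴴ * liftAB b)) := by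
            simp only [Matrix.mul_assoc]
        _ = _ := by rw [h4, Matrix.one_mul]; simp only [map_mul, Matrix.mul_assoc]
    let g := b' * G
    have hg : liftBC T * liftAB g = liftAB g * liftBC T := by
      have h2 := hYΔ' 1 hY1
      rw [Matrix.mul_one] at h2
      exact hcomm _ h2
    have hgx : g * (b * x * G')ᴴ = b' * xᴴ * b := by
      rw [Matrix.conjTranspose_mul, Matrix.conjTranspose_mul, hG'h, hbh]
      calc b' * G * (G' * (xᴴ * b)) = b' * (G * G') * xᴴ * b := by simp only [Matrix.mul_assoc]
        _ = _ := by rw [hGG, Matrix.mul_one]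
    have hg' : G' * b * g = 1 := by
      calc G' * b * (b' * G) = G' * (b * b') * G := by simp only [Matrix.mul_assoc]
        _ = 1 := by rw [hbb', Matrix.mul_one, hGG']
    have hg'' : liftAB (C := C) (G' * b) * liftAB g = 1 := by rw [← map_mul, hg', map_one]
    rw [← hgx, map_mul] at h1
    calc liftBC T * liftAB (b * x * G')ᴴ
        = (liftAB (G' * b) * liftAB g) * (liftBC T * liftAB (b * x * G')ᴴ) := by
          rw [hg'', Matrix.one_mul]
      _ = liftAB (G' * b) * (liftBC T * liftAB g) * liftAB (b * x * G')ᴴ := by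
          rw [hg]; simp only [Matrix.mul_assoc]
      _ = liftAB (G' * b) * (liftBC T * (liftAB g * liftAB (b * x * G')ᴴ)) := by
          simp only [Matrix.mul_assoc]
      _ = (liftAB (G' * b) * liftAB g) * liftAB (b * x * G')ᴴ * liftBC T := by
          rw [← h1]; simp only [Matrix.mul_assoc]
      _ = _ := by rw [hg'', Matrix.one_mul]
  have hcommH : ∀ x ∈ Y, liftBC T * liftAB xᴴ = liftAB xᴴ * liftBC T := by
    intro x hx
    have h1 := hcommΔ _ (hYΔ' x hx)
    have h2 : b * (b' * x * G) * G' = x := by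
      calc _ = (b * b') * x * (G * G') := by simp only [Matrix.mul_assoc]
        _ = x := by rw [hbb', hGG, Matrix.mul_one, Matrix.one_mul]
    rwa [h2] at h1
  let S : Set (Matrix B B ℂ) := {s | ∃ x ∈ Y, ∃ a a', s = sliceA x a a'}
  have hN : ∀ z, z ∈ StarSubalgebra.centralizer ℂ S ↔
      ∀ x ∈ Y, leftOne z * x = x * leftOne z ∧ leftOne z * xᴴ = xᴴ * leftOne z := by
    intro z
    rw [StarSubalgebra.mem_centralizer_iff]
    constructor
    · intro h x hx
      exact ⟨(leftOne_commute_iff _ _).2 fun a a' => (h _ ⟨x, hx, a, a', rfl⟩).1.symm,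
        (leftOne_commute_iff _ _).2 fun a a' => (h _ ⟨x, hx, a', a, rfl⟩).2.symm⟩
    · rintro h _ ⟨x, hx, a, a', rfl⟩
      exact ⟨((leftOne_commute_iff _ _).1 (h x hx).1 a a').symm,
        ((leftOne_commute_iff _ _).1 (h x hx).2 a' a).symm⟩
  have hTN : ∀ c c', sliceC T c c' ∈ StarSubalgebra.centralizer ℂ S := by
    intro c c'
    refine (hN _).2 fun x hx => ⟨(leftOne_commute_iff _ _).2 fun a a' => ?_,
      (leftOne_commute_iff _ _).2 fun a a' => ?_⟩
    · rw [← slice_liftBC_mul_liftAB, hcomm x hx, slice_liftAB_mul_liftBC]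
    · rw [← slice_liftBC_mul_liftAB, hcommH x hx, slice_liftAB_mul_liftBC]
  have hPN : P ∈ StarSubalgebra.centralizer ℂ S := by
    refine (hN _).2 fun x hx => ⟨hYP x hx, ?_⟩
    have h1 := congrArg Matrix.conjTranspose (hYP x hx)
    rw [Matrix.conjTranspose_mul, Matrix.conjTranspose_mul, ampl_conjTranspose, hP] at h1
    exact h1.symm
  obtain ⟨m, dL, dR, U, hdL, hdR, hU, hU', hNR, hNL, hRN⟩ := exists_commutant_structure S
  have hconj : ∀ z ∈ StarSubalgebra.centralizer ℂ S,
      β * z * β' ∈ StarSubalgebra.centralizer ℂ S := by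
    intro z hz
    have key : ∀ u : Matrix (A × B) (A × B) ℂ,
        leftOne z * (b' * u * b) = (b' * u * b) * leftOne z →
        leftOne (β * z * β') * u = u * leftOne (β * z * β') := by
      intro u hu
      rw [map_mul, map_mul]
      calc b * leftOne z * b' * u = b * leftOne z * b' * u * (b * b') := by
            rw [hbb', Matrix.mul_one]
        _ = b * (leftOne z * (b' * u * b)) * b' := by simp only [Matrix.mul_assoc]
        _ = (b * b') * u * (b * leftOne z * b') := by rw [hu]; simp only [Matrix.mul_assoc]
        _ = _ := by rw [hbb', Matrix.one_mul]
    have hz' := (hN z).1 hz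
    have hmul : ∀ u w : Matrix (A × B) (A × B) ℂ, leftOne z * u = u * leftOne z →
        leftOne z * w = w * leftOne z → leftOne z * (u * w) = u * w * leftOne z := by
      intro u w hu hw
      rw [← Matrix.mul_assoc, hu, Matrix.mul_assoc, hw, Matrix.mul_assoc]
    refine (hN _).2 fun x hx => ⟨key x ?_, key xᴴ ?_⟩
    · have h1 : b' * x * b = (b' * x * G) * (b * 1 * G')ᴴ := by
        rw [Matrix.mul_one, Matrix.conjTranspose_mul, hG'h, hbh]
        calc b' * x * b = b' * x * (G * G') * b := by rw [hGG, Matrix.mul_one]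
          _ = _ := by simp only [Matrix.mul_assoc]
      rw [h1]
      exact hmul _ _ (hz' _ (hYΔ' x hx)).1 (hz' _ (hYΔ 1 hY1)).2
    · have h1 : b' * xᴴ * b = (b' * 1 * G) * (b * x * G')ᴴ := by
        rw [Matrix.mul_one, Matrix.conjTranspose_mul, Matrix.conjTranspose_mul, hG'h, hbh]
        calc b' * xᴴ * b = b' * (G * G') * xᴴ * b := by rw [hGG, Matrix.mul_one]
          _ = _ := by simp only [Matrix.mul_assoc]
      rw [h1]
      exact hmul _ _ (hz' _ (hYΔ' 1 hY1)).1 (hz' _ (hYΔ x hx)).2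
  obtain ⟨βL, βR, hβLR⟩ := exists_blockForm_of_normalizes hdL hU hU' hβ fun R => by
    obtain ⟨R', hR'⟩ := hNR _ (hconj _ (hRN R))
    refine ⟨R', ?_⟩
    rw [← hR', Matrix.mul_assoc _ β' β, Matrix.nonsing_inv_mul _ hβu, Matrix.mul_one]
  choose TR hTR using fun c c' => hNR _ (hTN c c')
  obtain ⟨PR, hPR⟩ := hNR _ hPN
  have hGL : ∀ a a', ∃ L, sliceA (G * b') a a' = blockForm U L (fun _ => 1) := by
    intro a a'
    refine hNL _ fun z hz => ?_
    have h1 : G * b' = (b' * 1 * G)ᴴ := by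
      rw [Matrix.mul_one, Matrix.conjTranspose_mul, hGh, hb'h]
    rw [h1]
    exact ((leftOne_commute_iff _ _).1 ((hN z).1 hz _ (hYΔ' 1 hY1)).2 a a').symm
  choose M hM using hGL
  refine ⟨m, dL, dR, U, hdL, hdR, hU, hU', fun a a' j => M a a' j * βL j,
    fun c c' j => βR j * (TR c c' j * PR j), fun a a' c c' => ?_⟩
  have h1 : sliceA G a a' = sliceA (G * b') a a' * β := by
    rw [← sliceA_mul_leftOne, Matrix.mul_assoc]
    exact congrArg (sliceA · a a') ((Matrix.mul_one G).symm.trans (congrArg (G * ·) hb'b.symm))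
  have h2 : slice W a a' c c' = sliceA G a a' * sliceC T c c' :=
    (congrArg (slice · a a' c c') hWT).trans (slice_liftAB_mul_liftBC _ _ _ _ _ _)
  rw [h2, h1, hM, hTR, hβLR, hPR, blockForm_mul hU, Matrix.mul_assoc, blockForm_mul hU,
    blockForm_mul hU]
  simp only [Matrix.mul_one, Matrix.one_mul]

end Factorization

section Perturbation

/-- The projection onto the kernel of a positive semidefinite matrix. -/
theorem Matrix.PosSemidef.exists_kernel_projection {n : Type*} [Fintype n] [DecidableEq n]
    {b : Matrix n n ℂ} (hb : b.PosSemidef) :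
    ∃ τ : Matrix n n ℂ, τᴴ = τ ∧ τ * τ = τ ∧ b * τ = 0 ∧
      ∀ x y : ℝ, 0 < x → 0 < y → ((x : ℂ) • b + (y : ℂ) • τ).PosDef := by
  have hV := hb.1.isDiagonalization
  set V : Matrix n n ℂ := (hb.1.eigenvectorUnitary : Matrix n n ℂ)
  set d := hb.1.eigenvalues
  have hd : ∀ i, 0 ≤ d i := hb.eigenvalues_nonneg
  let δ : n → ℂ := fun i => if d i = 0 then 1 else 0
  have hmul : ∀ f g : n → ℂ, (V * diagonal f * Vᴴ) * (V * diagonal g * Vᴴ) =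
      V * diagonal (fun i => f i * g i) * Vᴴ := by
    intro f g
    calc _ = V * diagonal f * (Vᴴ * V) * diagonal g * Vᴴ := by simp only [Matrix.mul_assoc]
      _ = _ := by rw [hV.left, Matrix.mul_one, Matrix.mul_assoc V, Matrix.diagonal_mul_diagonal]
  refine ⟨V * diagonal δ * Vᴴ, ?_, ?_, ?_, fun x y hx hy => ?_⟩
  · have h1 : star δ = δ := by
      funext i
      simp only [δ, Pi.star_apply]
      split_ifs <;> simp
    rw [Matrix.conjTranspose_mul, Matrix.conjTranspose_mul, Matrix.conjTranspose_conjTranspose,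
      Matrix.diagonal_conjTranspose, h1, Matrix.mul_assoc]
  · rw [hmul]
    congr 3
    funext i
    simp [δ]
  · have h1 : b * (V * diagonal δ * Vᴴ) =
        (V * diagonal (fun i => (d i : ℂ)) * Vᴴ) * (V * diagonal δ * Vᴴ) := by rw [← hV.eq]
    rw [h1, hmul]
    have h2 : (fun i => (d i : ℂ) * δ i) = 0 := by
      funext i
      simp only [δ, Pi.zero_apply]
      split_ifs with h <;> simp [h]
    rw [h2]
    simp
  · have h1 : (x : ℂ) • b + (y : ℂ) • (V * diagonal δ * Vᴴ) =
        Vᴴᴴ * diagonal (fun i => ((x * d i + if d i = 0 then y else 0 : ℝ) : ℂ)) * Vᴴ := by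
      have h2 : (x : ℂ) • b = V * diagonal (fun i => (x : ℂ) * d i) * Vᴴ := by
        have h3 : diagonal (fun i => (x : ℂ) * d i) = (x : ℂ) • diagonal (fun i => (d i : ℂ)) := by
          rw [← Matrix.diagonal_smul]; rfl
        rw [h3, Matrix.mul_smul, Matrix.smul_mul, ← hV.eq]
      have h4 : (y : ℂ) • diagonal δ = diagonal (fun i => (y : ℂ) * δ i) := by
        rw [← Matrix.diagonal_smul]; rfl
      rw [h2, ← Matrix.smul_mul, ← Matrix.mul_smul, h4, ← Matrix.add_mul, ← Matrix.mul_add,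
        Matrix.diagonal_add, Matrix.conjTranspose_conjTranspose]
      congr 3
      funext i
      simp only [δ]
      split_ifs <;> simp
    rw [h1]
    refine Matrix.PosDef.conj_isometry (Matrix.PosDef.diagonal fun i => ?_) (by
      rw [Matrix.conjTranspose_conjTranspose, hV.right])
    rw [Complex.zero_lt_real]
    split_ifs with h
    · rw [h, mul_zero, zero_add]; exact hy
    · rw [add_zero]; exact mul_pos hx ((hd i).lt_of_ne' h)

theorem sylvester_perturb {R : Type*} [Ring R] [Algebra ℂ R] {g b τ ρ r X : R} {n t : ℂ}
    (hgτ : g * τ = 0) (hτg : τ * g = 0) (hbτ : b * τ = 0) (hτb : τ * b = 0) (hρτ : ρ * τ = 0)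
    (hτρ : τ * ρ = 0) (hrτ : r * τ = 0) (hτr : τ * r = 0) (hττ : τ * τ = τ)
    (hg : g * X + t • (X * ρ) = ρ) (hb : b * X + t • (X * r) = r) (hnt : n + t ≠ 0) :
    (g + b + n • τ) * ((1 - τ) * X * (1 - τ) + (n + t)⁻¹ • τ) +
      t • (((1 - τ) * X * (1 - τ) + (n + t)⁻¹ • τ) * (ρ + r + τ)) = ρ + r + τ := by
  have h1 : (g + b + n • τ) * ((1 - τ) * X * (1 - τ) + (n + t)⁻¹ • τ) =
      (1 - τ) * (g * X + b * X) * (1 - τ) + (n * (n + t)⁻¹) • τ := by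
    have e1 : (g + b + n • τ) * (1 - τ) = (1 - τ) * (g + b) := by
      simp only [add_mul, mul_add, sub_mul, mul_sub, one_mul, mul_one, smul_mul_assoc, hgτ, hτg,
        hbτ, hτb, hττ]
      abel
    have e2 : (g + b + n • τ) * τ = n • τ := by
      rw [add_mul, add_mul, hgτ, hbτ, smul_mul_assoc, hττ, zero_add, zero_add]
    rw [mul_add, ← mul_assoc, ← mul_assoc, e1, mul_smul_comm, e2, smul_smul, mul_comm n,
      mul_assoc _ _ X, add_mul g]
  have h2 : ((1 - τ) * X * (1 - τ) + (n + t)⁻¹ • τ) * (ρ + r + τ) =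
      (1 - τ) * (X * ρ + X * r) * (1 - τ) + (n + t)⁻¹ • τ := by
    have e1 : (1 - τ) * (ρ + r + τ) = (ρ + r) * (1 - τ) := by
      simp only [mul_add, sub_mul, mul_sub, one_mul, mul_one, hτρ, hτr, hρτ, hrτ, hττ, add_mul]
      abel
    have e2 : τ * (ρ + r + τ) = τ := by
      rw [mul_add, mul_add, hτρ, hτr, hττ, zero_add, zero_add]
    rw [add_mul, mul_assoc, e1, smul_mul_assoc, e2, ← mul_assoc, mul_assoc _ X, mul_add X]
  have h3 : (1 - τ) * (g * X + b * X) * (1 - τ) +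
      t • ((1 - τ) * (X * ρ + X * r) * (1 - τ)) = ρ + r := by
    have e1 : g * X + b * X + t • (X * ρ + X * r) = ρ + r := by
      conv_rhs => rw [← hg, ← hb]
      rw [smul_add]
      abel
    rw [← smul_mul_assoc, ← mul_smul_comm, ← add_mul, ← mul_add, e1]
    simp only [mul_add, sub_mul, mul_sub, one_mul, mul_one, hτρ, hτr, hρτ, hrτ, add_mul]
    simp
  have h4 : (n * (n + t)⁻¹) • τ + t • (n + t)⁻¹ • τ = τ := by
    rw [smul_smul, ← add_smul, ← add_mul, mul_inv_cancel₀ hnt, one_smul]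
  rw [h1, h2, smul_add]
  calc _ = ((1 - τ) * (g * X + b * X) * (1 - τ) + t • ((1 - τ) * (X * ρ + X * r) * (1 - τ))) +
        ((n * (n + t)⁻¹) • τ + t • (n + t)⁻¹ • τ) := by abel
    _ = _ := by rw [h3, h4]

variable {n r l : Type*} [Fintype n] [DecidableEq n] [Fintype r] [DecidableEq r] [Fintype l]
  [DecidableEq l]

theorem Matrix.PosSemidef.ampl {x : Matrix n n ℂ} (hx : x.PosSemidef) (f : l ≃ n × r) :
    (ampl f x).PosSemidef :=
  (hx.1.isDiagonalization.ampl f).posSemidef fun p => hx.eigenvalues_nonneg (f p).1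

theorem Matrix.PosDef.ampl {x : Matrix n n ℂ} (hx : x.PosDef) (f : l ≃ n × r) :
    (ampl f x).PosDef :=
  (hx.posSemidef.ampl f).posDef_iff_isUnit.2 (hx.isUnit.map (_root_.ampl f))

theorem ptr_ampl (f : l ≃ n × r) (x : Matrix n n ℂ) :
    ptr f (ampl f x) = (Fintype.card r : ℂ) • x := by
  ext i j
  have h : ∀ c, ampl f x (f.symm (i, c)) (f.symm (j, c)) = x i j := fun c => by
    rw [ampl_apply, f.apply_symm_apply, f.apply_symm_apply, Matrix.one_apply_eq, mul_one]
  simp only [ptr, Matrix.of_apply, h, Finset.sum_const, Finset.card_univ, Matrix.smul_apply,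
    nsmul_eq_mul, smul_eq_mul]

end Perturbation

section Factorization

variable {A B C : Type*} [Fintype A] [DecidableEq A] [Fintype B] [DecidableEq B] [Fintype C]
  [DecidableEq C]

omit [DecidableEq A] [Fintype B] [DecidableEq B] [Fintype C] [DecidableEq C] in
theorem margBC_add (V W : Matrix (A × B × C) (A × B × C) ℂ) :
    margBC (V + W) = margBC V + margBC W :=
  ptr_add (Equiv.prodComm A (B × C)) V W

omit [Fintype A] [DecidableEq A] [Fintype B] [DecidableEq B] [DecidableEq C] in
theorem margAB_add (V W : Matrix (A × B × C) (A × B × C) ℂ) :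
    margAB (V + W) = margAB V + margAB W :=
  ptr_add (Equiv.prodAssoc A B C).symm V W

theorem margBC_liftBC (T : Matrix (B × C) (B × C) ℂ) :
    margBC (liftBC (A := A) T) = (Fintype.card A : ℂ) • T := ptr_ampl _ _

theorem margAB_liftAB (x : Matrix (A × B) (A × B) ℂ) :
    margAB (liftAB (C := C) x) = (Fintype.card C : ℂ) • x := ptr_ampl _ _

/-- A positive operator vanishes on the kernel of its marginal. -/
theorem Matrix.PosSemidef.mul_lift_eq_zero {ρ : Matrix (A × B × C) (A × B × C) ℂ}
    (hρ : ρ.PosSemidef) {τ : Matrix B B ℂ} (hτ : τᴴ = τ) (h : margB ρ * τ = 0) :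
    ρ * liftBC (rightOne τ) = 0 := by
  refine hρ.mul_eq_zero_of_conj ?_
  have hps := hρ.conjTranspose_mul_mul_same (liftBC (rightOne τ))
  refine hps.trace_eq_zero_iff.1 ?_
  rw [ampl_conjTranspose, ampl_conjTranspose, hτ, Matrix.mul_assoc, trace_ampl_mul, ptr_mul_ampl,
    trace_ampl_mul, ptr_mul_ampl]
  have h1 : _root_.ptr (Equiv.refl (B × C)) (_root_.ptr (Equiv.prodComm A (B × C)) ρ) = margB ρ :=
    (margB_eq_ptr_margBC ρ).symm
  rw [h1, h, Matrix.mul_zero, Matrix.trace_zero]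

/-- Adding `1 ⊗ ρ_BC` and a projection onto the kernel of `ρ_B` preserves the Markov property. -/
theorem CMI_add_add_eq_zero {ρ : Matrix (A × B × C) (A × B × C) ℂ} (hρ : ρ.PosSemidef)
    (hI : CMI ρ = 0) {τ : Matrix B B ℂ} (hττ : τ * τ = τ) (hABτ : margAB ρ * leftOne τ = 0)
    (hτAB : leftOne τ * margAB ρ = 0) (hbτ : margB ρ * τ = 0) (hτb : τ * margB ρ = 0)
    (hρτ : ρ * liftBC (rightOne τ) = 0) (hτρ : liftBC (rightOne τ) * ρ = 0)
    (hrτ : liftBC (margBC ρ) * liftBC (A := A) (rightOne τ) = 0)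
    (hτr : liftBC (rightOne τ) * liftBC (A := A) (margBC ρ) = 0)
    (hW : (ρ + liftBC (margBC ρ) + liftBC (rightOne τ)).PosSemidef)
    (hWAB : margAB (ρ + liftBC (margBC ρ) + liftBC (rightOne τ)) =
      margAB ρ + leftOne (margB ρ) + (Fintype.card C : ℂ) • leftOne τ) :
    CMI (ρ + liftBC (margBC ρ) + liftBC (rightOne τ)) = 0 := by
  rw [CMI_eq_zero_iff_sylvester_BC hW]
  intro t ht
  obtain ⟨X, hX⟩ := (CMI_eq_zero_iff_sylvester_BC hρ).1 hI t ht
  have hX2 : liftAB (leftOne (margB ρ)) * liftBC (A := A) X +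
      (t : ℂ) • (liftBC (A := A) X * liftBC (margBC ρ)) = liftBC (margBC ρ) := by
    have h1 := congrArg margBC hX
    have h2 : margBC ((t : ℂ) • (liftBC X * ρ)) = (t : ℂ) • margBC (liftBC X * ρ) :=
      ptr_smul (Equiv.prodComm A (B × C)) _ _
    rw [margBC_add, h2, margBC_liftBC_mul, margBC_mul_liftBC, margBC_liftAB] at h1
    have h3 : ptr (Equiv.prodComm A B) (margAB ρ) = margB ρ := by
      ext i j
      rfl
    rw [h3] at h1
    have h4 := congrArg (liftBC (A := A)) h1
    rwa [map_add, map_smul, map_mul, map_mul, ← liftAB_leftOne] at h4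
  have h5 : ((Fintype.card C : ℂ) + t) ≠ 0 := by
    have h6 : (Fintype.card C : ℝ) + t ≠ 0 := by positivity
    exact_mod_cast h6
  have htAB : liftBC (rightOne τ) = liftAB (A := A) (C := C) (leftOne τ) :=
    (liftAB_leftOne τ).symm
  have hgτ : liftAB (C := C) (margAB ρ) * liftBC (rightOne τ) = 0 := by
    rw [htAB, ← map_mul, hABτ, map_zero]
  have hbτ' : liftAB (leftOne (margB ρ)) * liftBC (A := A) (C := C) (rightOne τ) = 0 := by
    rw [htAB, ← map_mul, ← map_mul, hbτ, map_zero, map_zero]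
  have hτb' : liftBC (A := A) (C := C) (rightOne τ) * liftAB (leftOne (margB ρ)) = 0 := by
    rw [htAB, ← map_mul, ← map_mul, hτb, map_zero, map_zero]
  have hττ' : liftBC (A := A) (C := C) (rightOne τ) * liftBC (rightOne τ) =
      liftBC (rightOne τ) := by
    rw [← map_mul, ← map_mul, hττ]
  have hτg : liftBC (rightOne τ) * liftAB (C := C) (margAB ρ) = 0 := by
    rw [htAB, ← map_mul, hτAB, map_zero]
  have h7 := sylvester_perturb hgτ hτg hbτ' hτb' hρτ hτρ hrτ hτr hττ' hX hX2 h5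
  have h8 : liftBC (A := A) ((1 - rightOne τ) * X * (1 - rightOne τ) +
      ((Fintype.card C : ℂ) + t)⁻¹ • rightOne τ) =
      (1 - liftBC (rightOne τ)) * liftBC X * (1 - liftBC (rightOne τ)) +
      ((Fintype.card C : ℂ) + t)⁻¹ • liftBC (rightOne τ) := by
    rw [map_add, map_mul, map_mul, map_sub, map_one, map_smul]
  have h9 : liftAB (C := C) (margAB ρ + leftOne (margB ρ) + (Fintype.card C : ℂ) • leftOne τ) =
      liftAB (margAB ρ) + liftAB (leftOne (margB ρ)) +
      (Fintype.card C : ℂ) • liftBC (rightOne τ) := by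
    rw [map_add, map_add, map_smul, htAB]
  refine ⟨(1 - rightOne τ) * X * (1 - rightOne τ) +
    ((Fintype.card C : ℂ) + t)⁻¹ • rightOne τ, ?_⟩
  rw [hWAB, h8, h9]
  exact h7

/-- The operator `ρ_ABC + 1_A ⊗ ρ_BC` is a direct sum of products over `B`. -/
theorem exists_blockForm_slice_add [Nonempty A] [Nonempty C]
    {ρ : Matrix (A × B × C) (A × B × C) ℂ} (hρ : ρ.PosSemidef) (hI : CMI ρ = 0) :
    ∃ (m : ℕ) (dL dR : Fin m → ℕ) (U : Matrix B (Σ j : Fin m, Fin (dL j) × Fin (dR j)) ℂ),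
      (∀ j, 0 < dL j) ∧ (∀ j, 0 < dR j) ∧ Uᴴ * U = 1 ∧ U * Uᴴ = 1 ∧
      ∃ (L : A → A → ∀ j, Matrix (Fin (dL j)) (Fin (dL j)) ℂ)
        (R : C → C → ∀ j, Matrix (Fin (dR j)) (Fin (dR j)) ℂ),
        ∀ a a' c c', slice (ρ + liftBC (margBC ρ)) a a' c c' = blockForm U (L a a') (R c c') := by
  have hρBC : (margBC ρ).PosSemidef := hρ.ptr (Equiv.prodComm A (B × C))
  have hρAB : (margAB ρ).PosSemidef := hρ.ptr (Equiv.prodAssoc A B C).symm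
  have hρB : (margB ρ).PosSemidef := by
    rw [margB_eq_ptr_margBC]
    exact hρBC.ptr (Equiv.refl (B × C))
  obtain ⟨τ, hτh, hττ, hbτ, hpos⟩ := hρB.exists_kernel_projection
  set b := margB ρ with hb
  let t' : Matrix (A × B × C) (A × B × C) ℂ := liftBC (rightOne τ)
  have htAB : t' = liftAB (leftOne τ) := (liftAB_leftOne τ).symm
  have hρτ : ρ * t' = 0 := hρ.mul_lift_eq_zero hτh hbτ
  have ht'h : t'ᴴ = t' := by rw [ampl_conjTranspose, ampl_conjTranspose, hτh]
  have flip : ∀ {x : Matrix (A × B × C) (A × B × C) ℂ}, xᴴ = x → x * t' = 0 → t' * x = 0 := by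
    intro x hx h
    have h1 := congrArg Matrix.conjTranspose h
    rwa [Matrix.conjTranspose_mul, ht'h, hx, Matrix.conjTranspose_zero] at h1
  have hτb : τ * b = 0 := by
    have h1 := congrArg Matrix.conjTranspose hbτ
    rwa [Matrix.conjTranspose_mul, hτh, hρB.1, Matrix.conjTranspose_zero] at h1
  have hBCτ : margBC ρ * rightOne τ = 0 := by
    rw [← margBC_mul_liftBC, hρτ]
    ext p q
    simp [margBC]
  have hABτ : margAB ρ * leftOne τ = 0 := by
    rw [← margAB_mul_liftAB, ← htAB, hρτ]
    ext p q
    simp [margAB]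
  have hτAB : leftOne τ * margAB ρ = 0 := by
    have h1 := congrArg Matrix.conjTranspose hABτ
    rwa [Matrix.conjTranspose_mul, ampl_conjTranspose, hτh, hρAB.1,
      Matrix.conjTranspose_zero] at h1
  let r := liftBC (A := A) (margBC ρ)
  have hrh : rᴴ = r := by rw [ampl_conjTranspose, hρBC.1]
  have hrτ : r * t' = 0 := by rw [← map_mul, hBCτ, map_zero]
  have hτpsd : τ.PosSemidef := by
    rw [← hττ]
    nth_rewrite 1 [← hτh]
    exact Matrix.posSemidef_conjTranspose_mul_self τ
  let W := ρ + r + t'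
  have hWpsd : W.PosSemidef := (hρ.add (hρBC.ampl _)).add ((hτpsd.ampl _).ampl _)
  have hcA : (0 : ℝ) < Fintype.card A := by exact_mod_cast Fintype.card_pos
  have hcC : (0 : ℝ) < Fintype.card C := by exact_mod_cast Fintype.card_pos
  have hWAB : margAB W = margAB ρ + leftOne b + (Fintype.card C : ℂ) • leftOne τ := by
    rw [margAB_add, margAB_add, margAB_liftBC, htAB, margAB_liftAB, ← margB_eq_ptr_margBC]
  have hWBC : margBC W = (1 + Fintype.card A : ℂ) • margBC ρ +
      (Fintype.card A : ℂ) • rightOne τ := by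
    rw [margBC_add, margBC_add, margBC_liftBC, margBC_liftBC, add_smul, one_smul]
  have hWB : margB W = ((1 + Fintype.card A : ℝ) : ℂ) • b +
      ((Fintype.card A * Fintype.card C : ℝ) : ℂ) • τ := by
    rw [margB_eq_ptr_margBC, hWBC, ptr_add, ptr_smul, ptr_smul, ptr_ampl, ← margB_eq_ptr_margBC,
      smul_smul]
    push_cast
    rfl
  have hWBpos : (margB W).PosDef := by
    rw [hWB]
    exact hpos _ _ (by positivity) (by positivity)
  have hWABpos : (margAB W).PosDef := by
    rw [hWAB, add_assoc, ← map_smul, ← map_add]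
    refine Matrix.PosDef.posSemidef_add hρAB (Matrix.PosDef.ampl ?_ _)
    have h1 := hpos 1 (Fintype.card C) one_pos hcC
    rwa [Complex.ofReal_one, one_smul, Complex.ofReal_natCast] at h1
  have hτr : t' * r = 0 := flip hrh hrτ
  have hWI : CMI W = 0 := CMI_add_add_eq_zero hρ hI hττ hABτ hτAB hbτ hτb hρτ
    (flip hρ.1 hρτ) hrτ hτr hWpsd hWAB
  have hK := (CMI_eq_zero_iff_sylvester_AB hWpsd).1 hWI
  have hcomm1 : leftOne (1 - τ) * margAB W = margAB W * leftOne (1 - τ) := by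
    rw [hWAB, map_sub, map_one]
    simp only [Matrix.sub_mul, Matrix.mul_sub, Matrix.one_mul, Matrix.mul_one, Matrix.mul_add,
      Matrix.add_mul, hτAB, hABτ, Matrix.mul_smul, Matrix.smul_mul, ← map_mul, hτb, hbτ, hττ]
    simp only [map_zero, sub_self, smul_zero, sub_zero, add_zero, zero_add, add_sub_cancel_right]
  have hcomm2 : (1 - τ) * margB W = margB W * (1 - τ) := by
    rw [hWB]
    simp only [Matrix.sub_mul, Matrix.mul_sub, Matrix.one_mul, Matrix.mul_one, Matrix.mul_add,
      Matrix.add_mul, Matrix.mul_smul, Matrix.smul_mul, hτb, hbτ, hττ]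
    simp only [sub_self, smul_zero, sub_zero, add_zero, zero_add, add_sub_cancel_right]
  obtain ⟨m, dL, dR, U, hdL, hdR, hU, hU', L, R, hLR⟩ := exists_blockForm_slice_mul hWpsd.1 hK
    ((Matrix.isUnit_iff_isUnit_det _).1 hWABpos.isUnit) hWBpos
    (P := 1 - τ) (by rw [Matrix.conjTranspose_sub, Matrix.conjTranspose_one, hτh]) hcomm1 hcomm2
  refine ⟨m, dL, dR, U, hdL, hdR, hU, hU', L, R, fun a a' c c' => ?_⟩
  rw [← hLR, ← slice_mul_lift]
  congr 1
  have hττ' : t' * t' = t' := by rw [← map_mul, ← map_mul, hττ]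
  rw [map_sub, map_one, map_sub, map_one, ← htAB, Matrix.mul_sub, Matrix.mul_one, Matrix.add_mul,
    Matrix.add_mul, hρτ, hrτ, hττ', zero_add, zero_add, add_sub_cancel_right]

end Factorization

section SliceDecomposition

variable {A B C : Type*} [Fintype A] [DecidableEq A] [Fintype B] [DecidableEq B] [Fintype C]
  [DecidableEq C] {m : ℕ} {dL dR : Fin m → ℕ}

/-- `blockForm` as a bilinear map. -/
noncomputable def blockFormBilin (U : Matrix B (Σ j : Fin m, Fin (dL j) × Fin (dR j)) ℂ) :
    (∀ j, Matrix (Fin (dL j)) (Fin (dL j)) ℂ) →ₗ[ℂ]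
      (∀ j, Matrix (Fin (dR j)) (Fin (dR j)) ℂ) →ₗ[ℂ] Matrix B B ℂ :=
  LinearMap.mk₂ ℂ (blockForm U)
    (fun L L' R => by
      rw [blockForm, blockForm, blockForm, ← Matrix.add_mul, ← Matrix.mul_add,
        ← Matrix.blockDiagonal'_add]
      congr 3
      funext j
      rw [Pi.add_apply, Pi.add_apply, Matrix.add_kronecker])
    (fun z L R => by
      rw [blockForm, blockForm, ← Matrix.smul_mul, ← Matrix.mul_smul,
        ← Matrix.blockDiagonal'_smul]
      congr 3
      funext j
      rw [Pi.smul_apply, Pi.smul_apply, Matrix.smul_kronecker])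
    (fun L R R' => by
      rw [blockForm, blockForm, blockForm, ← Matrix.add_mul, ← Matrix.mul_add,
        ← Matrix.blockDiagonal'_add]
      congr 3
      funext j
      rw [Pi.add_apply, Pi.add_apply, Matrix.kronecker_add])
    (fun z L R => by
      rw [blockForm, blockForm, ← Matrix.smul_mul, ← Matrix.mul_smul,
        ← Matrix.blockDiagonal'_smul]
      congr 3
      funext j
      rw [Pi.smul_apply, Pi.smul_apply, Matrix.kronecker_smul])

omit [Fintype B] [DecidableEq B] in
theorem blockFormBilin_apply (U : Matrix B (Σ j : Fin m, Fin (dL j) × Fin (dR j)) ℂ)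
    (L : ∀ j, Matrix (Fin (dL j)) (Fin (dL j)) ℂ) (R : ∀ j, Matrix (Fin (dR j)) (Fin (dR j)) ℂ) :
    blockFormBilin U L R = blockForm U L R := rfl

/-- If `I(A:C|B) = 0` then `ρ_ABC` is a direct sum of products over `B`. -/
theorem exists_blockForm_slice [Nonempty A] [Nonempty C]
    {ρ : Matrix (A × B × C) (A × B × C) ℂ} (hρ : ρ.PosSemidef) (hI : CMI ρ = 0) :
    ∃ (m : ℕ) (dL dR : Fin m → ℕ) (U : Matrix B (Σ j : Fin m, Fin (dL j) × Fin (dR j)) ℂ),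
      (∀ j, 0 < dL j) ∧ (∀ j, 0 < dR j) ∧ Uᴴ * U = 1 ∧ U * Uᴴ = 1 ∧
      ∃ (L : A → A → ∀ j, Matrix (Fin (dL j)) (Fin (dL j)) ℂ)
        (R : C → C → ∀ j, Matrix (Fin (dR j)) (Fin (dR j)) ℂ),
        ∀ a a' c c', slice ρ a a' c c' = blockForm U (L a a') (R c c') := by
  obtain ⟨m, dL, dR, U, hdL, hdR, hU, hU', L, R, h⟩ := exists_blockForm_slice_add hρ hI
  have hc : (1 + Fintype.card A : ℂ) ≠ 0 := by exact_mod_cast (Nat.add_comm 1 _ ▸ Nat.succ_ne_zero _ : 1 + Fintype.card A ≠ 0)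
  have hs : ∀ c c', sliceC (margBC ρ) c c' =
      blockForm U ((1 + Fintype.card A : ℂ)⁻¹ • ∑ a, L a a) (R c c') := by
    intro c c'
    have h1 : ∑ a, slice (ρ + liftBC (margBC ρ)) a a c c' =
        (1 + Fintype.card A : ℂ) • sliceC (margBC ρ) c c' := by
      ext b b'
      simp only [Matrix.sum_apply, Matrix.submatrix_apply, Matrix.add_apply, liftBC_apply,
        Matrix.one_apply_eq, mul_one, Finset.sum_add_distrib, Finset.sum_const, Finset.card_univ,
        Matrix.smul_apply, smul_eq_mul, nsmul_eq_mul, add_mul, one_mul]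
      rfl
    rw [← blockFormBilin_apply, map_smul, map_sum, LinearMap.smul_apply, LinearMap.sum_apply,
      eq_inv_smul_iff₀ hc, ← h1]
    exact Finset.sum_congr rfl fun a _ => h a a c c'
  refine ⟨m, dL, dR, U, hdL, hdR, hU, hU', fun a a' => L a a' -
    (1 : Matrix A A ℂ) a a' • (1 + Fintype.card A : ℂ)⁻¹ • ∑ a, L a a, R, fun a a' c c' => ?_⟩
  have h2 : slice ρ a a' c c' = slice (ρ + liftBC (margBC ρ)) a a' c c' -
      (1 : Matrix A A ℂ) a a' • sliceC (margBC ρ) c c' := by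
    ext b b'
    simp only [Matrix.submatrix_apply, Matrix.add_apply, Matrix.sub_apply, Matrix.smul_apply,
      smul_eq_mul, liftBC_apply]
    ring
  rw [h2, h, hs, ← blockFormBilin_apply, ← blockFormBilin_apply, ← LinearMap.smul_apply,
    ← map_smul, ← LinearMap.sub_apply, ← map_sub]
  rfl

end SliceDecomposition

section Assembly

variable {A B C : Type*} [Fintype A] [DecidableEq A] [Fintype B] [DecidableEq B] [Fintype C]
  [DecidableEq C] {m : ℕ} {dL dR : Fin m → ℕ}

omit [Fintype A] [DecidableEq A] [Fintype B] [DecidableEq B] [Fintype C] [DecidableEq C] in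
theorem ext_slice {V W : Matrix (A × B × C) (A × B × C) ℂ}
    (h : ∀ a a' c c', slice V a a' c c' = slice W a a' c c') : V = W := by
  ext ⟨a, b, c⟩ ⟨a', b', c'⟩
  exact congrFun (congrFun (h a a' c c') b) b'

omit [Fintype B] [DecidableEq B] in
theorem slice_conj_kronecker {ι : Type*} [Fintype ι] (U : Matrix B ι ℂ)
    (M : Matrix (A × ι × C) (A × ι × C) ℂ) (a a' : A) (c c' : C) :
    slice (((1 : Matrix A A ℂ) ⊗ₖ (U ⊗ₖ (1 : Matrix C C ℂ))) * M *
      ((1 : Matrix A A ℂ) ⊗ₖ (U ⊗ₖ (1 : Matrix C C ℂ)))ᴴ) a a' c c' =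
      U * slice M a a' c c' * Uᴴ := by
  ext b b'
  simp only [Matrix.submatrix_apply, Matrix.mul_apply, Matrix.conjTranspose_apply,
    Matrix.kroneckerMap_apply, Fintype.sum_prod_type, Matrix.one_apply, apply_ite star,
    star_zero, ite_mul, mul_ite, one_mul, mul_one, zero_mul, mul_zero,
    Finset.sum_ite_eq, Finset.sum_ite_irrel, Finset.sum_const_zero, Finset.mem_univ, if_true]

omit [Fintype A] [DecidableEq A] [Fintype C] [DecidableEq C] in
theorem slice_blockState (q : Fin m → ℝ)
    (ρL : ∀ j, Matrix (A × Fin (dL j)) (A × Fin (dL j)) ℂ)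
    (ρR : ∀ j, Matrix (Fin (dR j) × C) (Fin (dR j) × C) ℂ) (a a' : A) (c c' : C) :
    slice (blockState (fun j => Fin (dL j)) (fun j => Fin (dR j)) q ρL ρR) a a' c c' =
      Matrix.blockDiagonal' (fun j => ((q j : ℂ) • sliceA (ρL j) a a') ⊗ₖ sliceC (ρR j) c c') := by
  ext ⟨j, l, r⟩ ⟨j', l', r'⟩
  simp only [blockState, Matrix.reindex_apply, Matrix.submatrix_apply, assocEquiv,
    Equiv.coe_fn_symm_mk, Matrix.blockDiagonal'_apply]
  split_ifs with h
  · subst h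
    simp only [cast_eq, Matrix.smul_apply, Matrix.kroneckerMap_apply, Matrix.submatrix_apply,
      smul_eq_mul, mul_assoc]
  · rfl

omit [Fintype B] [DecidableEq B] in
/-- The `B`-blocks of a conjugated block state. -/
theorem slice_conj_blockState (U : Matrix B (Σ j : Fin m, Fin (dL j) × Fin (dR j)) ℂ)
    (q : Fin m → ℝ) (ρL : ∀ j, Matrix (A × Fin (dL j)) (A × Fin (dL j)) ℂ)
    (ρR : ∀ j, Matrix (Fin (dR j) × C) (Fin (dR j) × C) ℂ) (a a' : A) (c c' : C) :
    slice (((1 : Matrix A A ℂ) ⊗ₖ (U ⊗ₖ (1 : Matrix C C ℂ))) *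
      blockState (fun j => Fin (dL j)) (fun j => Fin (dR j)) q ρL ρR *
      ((1 : Matrix A A ℂ) ⊗ₖ (U ⊗ₖ (1 : Matrix C C ℂ)))ᴴ) a a' c c' =
      blockForm U (fun j => (q j : ℂ) • sliceA (ρL j) a a') (fun j => sliceC (ρR j) c c') := by
  rw [slice_conj_kronecker, slice_blockState, blockForm]

theorem isDensityMatrix_inv_card_smul_one {n : Type*} [Fintype n] [DecidableEq n] [Nonempty n] :
    IsDensityMatrix ((Fintype.card n : ℂ)⁻¹ • (1 : Matrix n n ℂ)) := by
  have h : (Fintype.card n : ℂ) ≠ 0 := by exact_mod_cast Fintype.card_ne_zero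
  refine ⟨Matrix.PosSemidef.one.smul (inv_nonneg.2 (Nat.cast_nonneg _)), ?_⟩
  rw [Matrix.trace_smul, Matrix.trace_one, smul_eq_mul, inv_mul_cancel₀ h]

/-- A positive product operator is a multiple of a product of density matrices. -/
theorem Matrix.PosSemidef.exists_isDensityMatrix_kronecker {n k : Type*} [Fintype n]
    [DecidableEq n] [Nonempty n] [Fintype k] [DecidableEq k] [Nonempty k] {X : Matrix n n ℂ}
    {Y : Matrix k k ℂ} (h : (X ⊗ₖ Y).PosSemidef) :
    ∃ (q : ℝ) (ρL : Matrix n n ℂ) (ρR : Matrix k k ℂ), 0 ≤ q ∧ IsDensityMatrix ρL ∧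
      IsDensityMatrix ρR ∧ X ⊗ₖ Y = (q : ℂ) • (ρL ⊗ₖ ρR) ∧ (q : ℂ) = (X ⊗ₖ Y).trace := by
  have hq := h.trace_nonneg
  obtain ⟨q, hq'⟩ : ∃ q : ℝ, (q : ℂ) = (X ⊗ₖ Y).trace :=
    ⟨(X ⊗ₖ Y).trace.re, (Complex.eq_re_of_ofReal_le hq).symm⟩
  have hq0 : 0 ≤ q := by rw [← hq'] at hq; exact_mod_cast hq
  rcases eq_or_ne q 0 with h0 | h0
  · refine ⟨q, _, _, hq0, isDensityMatrix_inv_card_smul_one, isDensityMatrix_inv_card_smul_one, ?_,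
      hq'⟩
    rw [h0, Complex.ofReal_zero, zero_smul]
    refine h.trace_eq_zero_iff.1 ?_
    rw [← hq', h0, Complex.ofReal_zero]
  have hXY : X.trace * Y.trace = (q : ℂ) := by rw [hq', Matrix.trace_kronecker]
  have hqc : (q : ℂ) ≠ 0 := by exact_mod_cast h0
  have hqi : (0 : ℂ) ≤ (q : ℂ)⁻¹ := inv_nonneg.2 (by exact_mod_cast hq0)
  have hX : X.trace ≠ 0 := left_ne_zero_of_mul (hXY ▸ hqc)
  have hY : Y.trace ≠ 0 := right_ne_zero_of_mul (hXY ▸ hqc)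
  have h1 : _root_.ptr (Equiv.refl (n × k)) (X ⊗ₖ Y) = Y.trace • X := by
    ext i j
    simp only [_root_.ptr, Matrix.of_apply, Equiv.refl_symm, Equiv.refl_apply,
      Matrix.kroneckerMap_apply, Matrix.smul_apply, smul_eq_mul, Matrix.trace, Matrix.diag_apply]
    rw [← Finset.mul_sum, mul_comm]
  have h2 : _root_.ptr (Equiv.prodComm n k) (X ⊗ₖ Y) = X.trace • Y := by
    ext i j
    simp [_root_.ptr, Matrix.trace, Finset.sum_mul]
  refine ⟨q, (q : ℂ)⁻¹ • Y.trace • X, (q : ℂ)⁻¹ • X.trace • Y, hq0, ⟨?_, ?_⟩, ⟨?_, ?_⟩, ?_, hq'⟩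
  · rw [← h1]
    exact (h.ptr _).smul hqi
  · rw [Matrix.trace_smul, Matrix.trace_smul, smul_eq_mul, smul_eq_mul, mul_comm Y.trace, hXY,
      inv_mul_cancel₀ hqc]
  · rw [← h2]
    exact (h.ptr _).smul hqi
  · rw [Matrix.trace_smul, Matrix.trace_smul, smul_eq_mul, smul_eq_mul, hXY, inv_mul_cancel₀ hqc]
  · rw [Matrix.smul_kronecker, Matrix.kronecker_smul, Matrix.smul_kronecker,
      Matrix.kronecker_smul]
    simp only [smul_smul]
    rw [← hXY]
    field_simp
    rw [one_smul]

omit [DecidableEq B] in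
/-- An operator all of whose `B`-blocks are in product form is a block state. -/
theorem exists_blockState_of_slice_eq [Nonempty A] [Nonempty C]
    {ρ : Matrix (A × B × C) (A × B × C) ℂ} (hρ : IsDensityMatrix ρ)
    {U : Matrix B (Σ j : Fin m, Fin (dL j) × Fin (dR j)) ℂ} (hdL : ∀ j, 0 < dL j)
    (hdR : ∀ j, 0 < dR j) (hU : Uᴴ * U = 1)
    {L : A → A → ∀ j, Matrix (Fin (dL j)) (Fin (dL j)) ℂ}
    {R : C → C → ∀ j, Matrix (Fin (dR j)) (Fin (dR j)) ℂ}
    (h : ∀ a a' c c', slice ρ a a' c c' = blockForm U (L a a') (R c c')) :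
    ∃ (q : Fin m → ℝ) (ρL : ∀ j, Matrix (A × Fin (dL j)) (A × Fin (dL j)) ℂ)
      (ρR : ∀ j, Matrix (Fin (dR j) × C) (Fin (dR j) × C) ℂ),
      (∀ j, 0 ≤ q j) ∧ (∑ j, q j = 1) ∧
      (∀ j, IsDensityMatrix (ρL j)) ∧ (∀ j, IsDensityMatrix (ρR j)) ∧
      ρ = ((1 : Matrix A A ℂ) ⊗ₖ (U ⊗ₖ (1 : Matrix C C ℂ))) *
        blockState (fun j => Fin (dL j)) (fun j => Fin (dR j)) q ρL ρR *
        ((1 : Matrix A A ℂ) ⊗ₖ (U ⊗ₖ (1 : Matrix C C ℂ)))ᴴ := by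
  set V := (1 : Matrix A A ℂ) ⊗ₖ (U ⊗ₖ (1 : Matrix C C ℂ)) with hV
  have hVV : Vᴴ * V = 1 := by
    rw [hV, Matrix.conjTranspose_kronecker, Matrix.conjTranspose_kronecker,
      Matrix.conjTranspose_one, Matrix.conjTranspose_one, ← Matrix.mul_kronecker_mul,
      ← Matrix.mul_kronecker_mul, hU, Matrix.mul_one, Matrix.mul_one, Matrix.one_kronecker_one,
      Matrix.one_kronecker_one]
  let X : ∀ j, Matrix (A × Fin (dL j)) (A × Fin (dL j)) ℂ :=
    fun j => Matrix.of fun p q => L p.1 q.1 j p.2 q.2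
  let Y : ∀ j, Matrix (Fin (dR j) × C) (Fin (dR j) × C) ℂ :=
    fun j => Matrix.of fun p q => R p.2 q.2 j p.1 q.1
  let M := blockState (fun j => Fin (dL j)) (fun j => Fin (dR j)) (fun _ => 1) X Y
  have hM : ρ = V * M * Vᴴ := by
    refine ext_slice fun a a' c c' => ?_
    rw [slice_conj_blockState, h]
    congr 1
    funext j
    rw [Complex.ofReal_one, one_smul]
    rfl
  have hM' : M = Vᴴ * ρ * V := by
    rw [hM]
    calc M = (Vᴴ * V) * M * (Vᴴ * V) := by rw [hVV, Matrix.one_mul, Matrix.mul_one]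
      _ = _ := by simp only [Matrix.mul_assoc]
  have hMpsd : M.PosSemidef := by
    rw [hM']
    exact hρ.1.conjTranspose_mul_mul_same V
  have hblock : ∀ j, (X j ⊗ₖ Y j).PosSemidef := fun j => by
    have h1 := hMpsd.submatrix fun p : (A × Fin (dL j)) × (Fin (dR j) × C) =>
      assocEquiv A C (fun j => Fin (dL j)) (fun j => Fin (dR j)) ⟨j, p⟩
    convert h1 using 1
    ext p q
    simp only [M, blockState, Matrix.reindex_apply, Matrix.submatrix_apply,
      Equiv.symm_apply_apply, Matrix.blockDiagonal'_apply_eq, Complex.ofReal_one, one_smul]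
  have : ∀ j, Nonempty (Fin (dL j)) := fun j => ⟨⟨0, hdL j⟩⟩
  have : ∀ j, Nonempty (Fin (dR j)) := fun j => ⟨⟨0, hdR j⟩⟩
  choose q ρL ρR hq hL hR hXY htr using fun j => (hblock j).exists_isDensityMatrix_kronecker
  refine ⟨q, ρL, ρR, hq, ?_, hL, hR, ?_⟩
  · have h1 : ρ.trace = ∑ j, (q j : ℂ) := by
      rw [hM, Matrix.trace_mul_comm, ← Matrix.mul_assoc, hVV, Matrix.one_mul]
      have h2 : M.trace = (Matrix.blockDiagonal' fun j =>
          ((1 : ℝ) : ℂ) • (X j ⊗ₖ Y j)).trace :=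
        (Equiv.sum_comp (assocEquiv A C _ _).symm
          (fun p => (Matrix.blockDiagonal' fun j => ((1 : ℝ) : ℂ) • (X j ⊗ₖ Y j)) p p))
      rw [h2, Matrix.trace_blockDiagonal']
      exact Finset.sum_congr rfl fun j _ => by rw [htr, Complex.ofReal_one, one_smul]
    rw [hρ.2] at h1
    exact_mod_cast h1.symm
  · rw [hM]
    congr 2
    simp only [M, blockState]
    congr 2
    funext j
    rw [Complex.ofReal_one, one_smul, hXY]

omit [DecidableEq B] [DecidableEq C] in
theorem sliceC_mul (S T : Matrix (B × C) (B × C) ℂ) (c c' : C) :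
    sliceC (S * T) c c' = ∑ d, sliceC S c d * sliceC T d c' := by
  ext b b'
  simp only [Matrix.submatrix_apply, Matrix.mul_apply, Matrix.sum_apply, Fintype.sum_prod_type]
  exact Finset.sum_comm

theorem sliceC_rightOne_mul (x : Matrix B B ℂ) (T : Matrix (B × C) (B × C) ℂ) (c c' : C) :
    sliceC (rightOne x * T) c c' = x * sliceC T c c' := by
  ext b b'
  simp only [Matrix.submatrix_apply, Matrix.mul_apply, rightOne_apply, Fintype.sum_prod_type,
    Matrix.one_apply, mul_ite, mul_one, mul_zero, ite_mul, zero_mul, Finset.sum_ite_eq,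
    Finset.mem_univ, if_true]

theorem exists_rightOne_sylvester {T : Matrix (B × C) (B × C) ℂ} (hT : T.PosSemidef) {t : ℝ}
    (ht : 0 < t) :
    ∃ X, rightOne (ptr (Equiv.refl (B × C)) T) * X + (t : ℂ) • (X * T) = T := by
  have hr := hT.ptr (Equiv.refl (B × C))
  obtain ⟨X, hX, -⟩ := exists_sylvester (hr.1.isDiagonalization.ampl (Equiv.refl (B × C)))
    hT.1.isDiagonalization (fun p => hr.eigenvalues_nonneg _) hT.eigenvalues_nonneg ht
  exact ⟨X, hX⟩

/-- Block states are Markov chains. -/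
theorem CMI_eq_zero_of_slice_eq {ρ : Matrix (A × B × C) (A × B × C) ℂ} (hρ : ρ.PosSemidef)
    {U : Matrix B (Σ j : Fin m, Fin (dL j) × Fin (dR j)) ℂ} (hU : Uᴴ * U = 1)
    (L : A → A → ∀ j, Matrix (Fin (dL j)) (Fin (dL j)) ℂ)
    (ρR : ∀ j, Matrix (Fin (dR j) × C) (Fin (dR j) × C) ℂ) (hR : ∀ j, (ρR j).PosSemidef)
    (h : ∀ a a' c c', slice ρ a a' c c' =
      blockForm U (L a a') (fun j => sliceC (ρR j) c c')) : CMI ρ = 0 := by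
  rw [CMI_eq_zero_iff_sylvester_BC hρ]
  intro t ht
  choose X hX using fun j => exists_rightOne_sylvester (hR j) ht
  have hAB : ∀ a a', sliceA (margAB ρ) a a' =
      blockForm U (L a a') (fun j => ptr (Equiv.refl _) (ρR j)) := by
    intro a a'
    have h1 : sliceA (margAB ρ) a a' = ∑ c, slice ρ a a' c c := by
      ext b b'
      simp only [Matrix.submatrix_apply, Matrix.sum_apply]
      rfl
    rw [h1, Finset.sum_congr rfl fun c _ => h a a' c c]
    simp only [← blockFormBilin_apply]
    rw [← map_sum]
    congr 1
    funext j
    ext r r'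
    simp only [Finset.sum_apply, Matrix.sum_apply]
    rfl
  let T : Matrix (B × C) (B × C) ℂ := Matrix.of fun p q =>
    blockForm U (fun _ => 1) (fun j => sliceC (X j) p.2 q.2) p.1 q.1
  have hT : ∀ c c', sliceC T c c' = blockForm U (fun _ => 1) (fun j => sliceC (X j) c c') :=
    fun c c' => rfl
  refine ⟨T, ext_slice fun a a' c c' => ?_⟩
  have h1 : slice (liftAB (margAB ρ) * liftBC T) a a' c c' = blockForm U (L a a')
      (fun j => sliceC (rightOne (ptr (Equiv.refl _) (ρR j)) * X j) c c') := by
    rw [slice_liftAB_mul_liftBC, hAB, hT, blockForm_mul hU]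
    simp only [Matrix.mul_one, sliceC_rightOne_mul]
  have h2 : slice (liftBC T * ρ) a a' c c' =
      blockForm U (L a a') (fun j => sliceC (X j * ρR j) c c') := by
    rw [slice_liftBC_mul]
    simp only [hT, h, blockForm_mul hU, Matrix.one_mul, sliceC_mul]
    simp only [← blockFormBilin_apply]
    rw [← map_sum]
    congr 1
    funext j
    rw [Finset.sum_apply]
  have h3 : slice (liftAB (margAB ρ) * liftBC T + (t : ℂ) • (liftBC T * ρ)) a a' c c' =
      slice (liftAB (margAB ρ) * liftBC T) a a' c c' +
        (t : ℂ) • slice (liftBC T * ρ) a a' c c' := rfl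
  rw [h3, h1, h2, h, ← blockFormBilin_apply, ← blockFormBilin_apply, ← map_smul, ← map_add,
    blockFormBilin_apply]
  congr 1
  funext j
  conv_rhs => rw [← hX j]
  rfl


end Assembly

/-- **structure theorem for quantum Markov chains, Hayden–Jozsa–Petz–Winter.**
A density matrix `ρ_ABC` satisfies `I(A:C|B)_ρ = 0` if and only if `H_B` admits an
orthogonal direct sum decomposition `H_B = ⊕ⱼ H_{bLⱼ} ⊗ H_{bRⱼ}` (a unitary `U`)
such that `ρ_ABC = ⊕ⱼ qⱼ ρ_{A bLⱼ} ⊗ ρ_{bRⱼ C}` for density matrices `ρ_{A bLⱼ}`,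
`ρ_{bRⱼ C}` and a probability distribution `(qⱼ)`. -/
theorem markov_chain_iff_block_decomposition
    {A B C : Type*} [Fintype A] [DecidableEq A] [Fintype B] [DecidableEq B]
    [Fintype C] [DecidableEq C]
    (ρ : Matrix (A × B × C) (A × B × C) ℂ) (hρ : IsDensityMatrix ρ) :
    CMI ρ = 0 ↔
      ∃ (m : ℕ) (dL dR : Fin m → ℕ)
        (U : Matrix B (Σ j : Fin m, Fin (dL j) × Fin (dR j)) ℂ)
        (q : Fin m → ℝ)
        (ρL : ∀ j, Matrix (A × Fin (dL j)) (A × Fin (dL j)) ℂ)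
        (ρR : ∀ j, Matrix (Fin (dR j) × C) (Fin (dR j) × C) ℂ),
        Uᴴ * U = 1 ∧ U * Uᴴ = 1 ∧
        (∀ j, 0 ≤ q j) ∧ (∑ j, q j = 1) ∧
        (∀ j, IsDensityMatrix (ρL j)) ∧ (∀ j, IsDensityMatrix (ρR j)) ∧
        ρ = ((1 : Matrix A A ℂ) ⊗ₖ (U ⊗ₖ (1 : Matrix C C ℂ))) *
            blockState (fun j => Fin (dL j)) (fun j => Fin (dR j)) q ρL ρR *
            ((1 : Matrix A A ℂ) ⊗ₖ (U ⊗ₖ (1 : Matrix C C ℂ)))ᴴ := by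
  constructor
  · intro hI
    have hne : Nonempty (A × B × C) := by
      by_contra h
      rw [not_nonempty_iff] at h
      have h1 := hρ.2
      rw [Matrix.trace, Finset.univ_eq_empty, Finset.sum_empty] at h1
      exact zero_ne_one h1
    obtain ⟨a, -, c⟩ := hne
    have : Nonempty A := ⟨a⟩
    have : Nonempty C := ⟨c⟩
    obtain ⟨m, dL, dR, U, hdL, hdR, hU, hU', L, R, h⟩ := exists_blockForm_slice hρ.1 hI
    obtain ⟨q, ρL, ρR, h'⟩ := exists_blockState_of_slice_eq hρ hdL hdR hU h
    exact ⟨m, dL, dR, U, q, ρL, ρR, hU, hU', h'⟩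
  · rintro ⟨m, dL, dR, U, q, ρL, ρR, hU, -, -, -, -, hR, h⟩
    refine CMI_eq_zero_of_slice_eq hρ.1 hU (fun a a' j => (q j : ℂ) • sliceA (ρL j) a a') ρR
      (fun j => (hR j).1) fun a a' c c' => ?_
    rw [h, slice_conj_blockState]
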